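/- (Doubly nonlinear diffusion, Euclidean case.) Let N ≥ 1, p > 1 and γ ≥ 1, and set m = (γ−1)(p−1)+1 and f ≡ γ^{p−1}. Let a : ℝ^N → ℝ be locally Lipschitz, bounded, with a > 0 a.e., and V ≡ 1. If max(1, γ(p−1)) < q ≤ p/N + γ(p−1), then every global nonnegative weak solution of ∂_t u ≥ (1/a) div(a u^{m−1} |∇u|^{p−2} f(|∇u|) ∇u) + u^q (which for a ≡ 1 is the weak form of ∂_t u ≥ Δ_p(u^γ) + u^q) on S = ℝ^N × (0,∞) is zero a.e. In particular such q exist only when p > N(γ+1)/(γN+1). -/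

import Mathlib

open MeasureTheory Real Set Metric
open scoped ENNReal RealInnerProductSpace

noncomputable section

/-- Euclidean space `ℝ^N`. -/
abbrev Euc (N : ℕ) : Type := EuclideanSpace ℝ (Fin N)

/-- The parabolic slab `S = ℝ^N × (0,∞)`. -/
def Sset (N : ℕ) : Set (Euc N × ℝ) := {z : Euc N × ℝ | 0 < z.2}

/-- The weighted measure `μ_a = a(x) dx` on `ℝ^N`. -/
def muA {N : ℕ} (a : Euc N → ℝ) : Measure (Euc N) :=
  (volume : Measure (Euc N)).withDensity (fun x => ENNReal.ofReal (a x))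

/-- The measure `dμ_a dt` on `ℝ^N × (0,∞)`. -/
def muS {N : ℕ} (a : Euc N → ℝ) : Measure (Euc N × ℝ) :=
  (muA a).prod ((volume : Measure ℝ).restrict (Set.Ioi (0 : ℝ)))

/-- The continuous linear functional `(w, τ) ↦ ⟪v, w⟫ + c·τ` on `ℝ^N × ℝ`,
encoding a space-time differential with spatial gradient `v` and time derivative `c`. -/
def pairCLM {N : ℕ} (v : Euc N) (c : ℝ) : (Euc N × ℝ) →L[ℝ] ℝ :=
  ((innerSL ℝ v).comp (ContinuousLinearMap.fst ℝ (Euc N) ℝ)) +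
    c • (ContinuousLinearMap.snd ℝ (Euc N) ℝ)

/-- `u` is a global nonnegative weak solution of
`∂ₜ u ≥ (1/a) div(a u^{m-1} |∇u|^{p-2} f(|∇u|) ∇u) + V u^q` on `S = ℝ^N × (0,∞)`,
where `gu`, `ut` are a.e. representatives of the spatial gradient and the time
derivative of `u`. -/
structure IsWeakSol (N : ℕ) (p m q : ℝ) (V : Euc N × ℝ → ℝ) (f : ℝ → ℝ)
    (a : Euc N → ℝ) (u : Euc N × ℝ → ℝ) (gu : Euc N × ℝ → Euc N)
    (ut : Euc N × ℝ → ℝ) : Prop where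
  nonneg : ∀ z ∈ Sset N, 0 ≤ u z
  locLip : LocallyLipschitzOn (Sset N) u
  deriv_ae : ∀ᵐ z ∂ ((volume : Measure (Euc N × ℝ)).restrict (Sset N)),
      DifferentiableAt ℝ u z → HasFDerivAt u (pairCLM (gu z) (ut z)) z
  int_uqV : LocallyIntegrableOn (fun z => u z ^ q * V z) (Sset N) (muS a)
  int_upm : LocallyIntegrableOn (fun z => u z ^ (p + m - 1)) (Sset N) (muS a)
  int_gu : LocallyIntegrableOn (fun z => ‖gu z‖ ^ p * u z ^ (m - 1)) (Sset N) (muS a)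
  int_ut : LocallyIntegrableOn (fun z => u z * ut z) (Sset N) (muS a)
  weak_ineq : ∀ (ψ : Euc N × ℝ → ℝ) (gψ : Euc N × ℝ → Euc N) (tψ : Euc N × ℝ → ℝ),
      (∀ z, 0 ≤ ψ z) → LocallyLipschitz ψ → HasCompactSupport ψ →
      tsupport ψ ⊆ Sset N →
      (∀ᵐ z ∂ (volume : Measure (Euc N × ℝ)),
        DifferentiableAt ℝ ψ z → HasFDerivAt ψ (pairCLM (gψ z) (tψ z)) z) →
      ∫ z, ψ z * u z ^ q * V z ∂ muS a ≤
        (∫ z, ⟪gψ z, gu z⟫ * u z ^ (m - 1) * ‖gu z‖ ^ (p - 2) * f ‖gu z‖ ∂ muS a)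
          - ∫ z, tψ z * u z ∂ muS a

/-- The region `E_R = {(x,t) ∈ S : |x|^θ2 + t^θ1 ≤ R^θ2}`. -/
def ESet (N : ℕ) (θ1 θ2 R : ℝ) : Set (Euc N × ℝ) :=
  {z ∈ Sset N | ‖z.1‖ ^ θ2 + z.2 ^ θ1 ≤ R ^ θ2}

/-- The time cutoff `χ_β`. -/
def chi (β t : ℝ) : ℝ := min 1 (max 0 (t / β - 1))

section WeakSolutions

open Filter Topology

variable {N : ℕ}

lemma isOpen_Sset : IsOpen (Sset N) := isOpen_lt continuous_const continuous_snd

instance isAddHaarMeasure_volume_prod :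
    (volume : Measure (Euc N × ℝ)).IsAddHaarMeasure := by
  rw [Measure.volume_eq_prod]; infer_instance

lemma nonneg_of_ae_pos {a : Euc N → ℝ} (haLip : LocallyLipschitz a)
    (haPos : ∀ᵐ x ∂ (volume : Measure (Euc N)), 0 < a x) (x : Euc N) : 0 ≤ a x := by
  have hd : Dense {x : Euc N | 0 < a x} := Measure.dense_of_ae haPos
  have hc : IsClosed {x : Euc N | 0 ≤ a x} := isClosed_le continuous_const haLip.continuous
  have := hc.closure_subset_iff.2 (fun x (hx : 0 < a x) => hx.le)
  exact this (hd x)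

lemma muS_eq_withDensity {a : Euc N → ℝ} (ha : Measurable a) :
    muS a = ((volume : Measure (Euc N × ℝ)).restrict (Sset N)).withDensity
      (fun z => ENNReal.ofReal (a z.1)) := by
  have h : (volume : Measure (Euc N × ℝ)).restrict (Sset N) =
      (volume : Measure (Euc N)).prod ((volume : Measure ℝ).restrict (Ioi 0)) := by
    have : Sset N = (univ : Set (Euc N)) ×ˢ Ioi (0 : ℝ) := by
      ext z; simp [Sset]
    rw [this, Measure.volume_eq_prod, ← Measure.prod_restrict, Measure.restrict_univ]
  rw [h, muS, muA, prod_withDensity_left (by fun_prop)]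

lemma muS_absolutelyContinuous {a : Euc N → ℝ} (ha : Measurable a) :
    muS a ≪ (volume : Measure (Euc N × ℝ)).restrict (Sset N) := by
  rw [muS_eq_withDensity ha]; exact withDensity_absolutelyContinuous _ _

lemma absolutelyContinuous_muS {a : Euc N → ℝ} (ha : Measurable a)
    (haPos : ∀ᵐ x ∂ (volume : Measure (Euc N)), 0 < a x) :
    (volume : Measure (Euc N × ℝ)).restrict (Sset N) ≪ muS a := by
  rw [muS_eq_withDensity ha]
  refine withDensity_absolutelyContinuous' (by fun_prop) ?_
  refine ae_restrict_of_ae ?_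
  have := (Measure.quasiMeasurePreserving_fst (μ := (volume : Measure (Euc N)))
    (ν := (volume : Measure ℝ))).ae haPos
  filter_upwards [this] with z hz
  simpa using hz

lemma ae_mem_Sset {a : Euc N → ℝ} (ha : Measurable a) : ∀ᵐ z ∂ muS a, z ∈ Sset N :=
  (muS_absolutelyContinuous ha).ae_le (ae_restrict_mem isOpen_Sset.measurableSet)

lemma integral_muS_eq {a : Euc N → ℝ} (ha : Measurable a) (ha0 : ∀ x, 0 ≤ a x)
    (F : Euc N × ℝ → ℝ) :
    ∫ z, F z ∂ muS a = ∫ z in Sset N, a z.1 * F z := by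
  rw [muS_eq_withDensity ha, integral_withDensity_eq_integral_toReal_smul₀ (by fun_prop)
    (by simp)]
  simp [ENNReal.toReal_ofReal (ha0 _)]

lemma muS_prod_le {a : Euc N → ℝ} {Ca : ℝ} (hCa : ∀ x, |a x| ≤ Ca)
    (A : Set (Euc N)) (hA : MeasurableSet A) (B : Set ℝ) :
    muS a (A ×ˢ B) ≤ ENNReal.ofReal Ca * volume A * volume B := by
  rw [muS, Measure.prod_prod]
  gcongr
  · rw [muA, withDensity_apply _ hA]
    calc ∫⁻ x in A, ENNReal.ofReal (a x) ≤ ∫⁻ x in A, ENNReal.ofReal Ca := by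
          exact lintegral_mono fun x =>
            ENNReal.ofReal_le_ofReal ((le_abs_self _).trans (hCa x))
      _ = _ := by simp
  · exact Measure.restrict_le_self

lemma muS_compact_lt_top {a : Euc N → ℝ} {Ca : ℝ} (hCa : ∀ x, |a x| ≤ Ca)
    {K : Set (Euc N × ℝ)} (hK : IsCompact K) : muS a K < ⊤ := by
  have h1 := (hK.image continuous_fst)
  have h2 := (hK.image continuous_snd)
  refine (measure_mono (subset_fst_image_prod_snd_image : K ⊆ _)).trans_lt ?_
  refine (muS_prod_le hCa _ h1.measurableSet _).trans_lt ?_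
  exact ENNReal.mul_lt_top (ENNReal.mul_lt_top ENNReal.ofReal_lt_top h1.measure_lt_top)
    h2.measure_lt_top

/-- A locally Lipschitz function with compact support is globally Lipschitz. -/
lemma exists_lipschitzWith_of_hasCompactSupport {E : Type*} [PseudoMetricSpace E] [ProperSpace E]
    {g : E → ℝ} (hg : LocallyLipschitz g) (hs : HasCompactSupport g) : ∃ C, LipschitzWith C g := by
  have hK : IsCompact (cthickening 1 (tsupport g)) := hs.isCompact.cthickening
  obtain ⟨C, hC⟩ := (hg.locallyLipschitzOn (s := cthickening 1 (tsupport g))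
    ).exists_lipschitzOnWith_of_compact hK
  obtain ⟨M, hM⟩ := hs.exists_bound_of_continuous hg.continuous
  have hM0 : ∀ x : E, 0 ≤ M := fun x => (norm_nonneg _).trans (hM x)
  have key : ∀ x y, x ∈ tsupport g → dist (g x) (g y) ≤ max (C : ℝ) M * dist x y := by
    intro x y hx
    by_cases hy : y ∈ cthickening 1 (tsupport g)
    · refine (hC.dist_le_mul x (self_subset_cthickening _ hx) y hy).trans ?_
      gcongr
      exact le_max_left _ _
    · have hd : 1 ≤ dist x y := by
        by_contra! hlt
        exact hy (mem_cthickening_of_dist_le y x 1 _ hx (by rw [dist_comm]; exact hlt.le))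
      have hgy : g y = 0 := image_eq_zero_of_notMem_tsupport
        fun h => hy (self_subset_cthickening _ h)
      rw [hgy, dist_zero_right]
      calc ‖g x‖ ≤ M * 1 := by simpa using hM x
        _ ≤ max (C : ℝ) M * dist x y := by
          gcongr
          exact le_max_right _ _
  refine ⟨max C M.toNNReal, LipschitzWith.of_dist_le_mul fun x y => ?_⟩
  have hmax : ((max C M.toNNReal : NNReal) : ℝ) = max (C : ℝ) M := by
    rw [NNReal.coe_max, Real.coe_toNNReal _ (hM0 x)]
  rw [hmax]
  by_cases hx : x ∈ tsupport g
  · exact key x y hx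
  by_cases hy : y ∈ tsupport g
  · rw [dist_comm, dist_comm x]; exact key y x hy
  · rw [image_eq_zero_of_notMem_tsupport hx, image_eq_zero_of_notMem_tsupport hy, dist_self]
    exact mul_nonneg (C.coe_nonneg.trans (le_max_left _ _)) dist_nonneg

lemma LocallyLipschitz.mul_real {E : Type*} [PseudoEMetricSpace E] {f g : E → ℝ}
    (hf : LocallyLipschitz f) (hg : LocallyLipschitz g) : LocallyLipschitz fun x => f x * g x :=
  (contDiff_mul (𝕜 := ℝ) (𝔸 := ℝ) (n := 1)).locallyLipschitz.comp (hf.prodMk hg)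

/-- A cutoff times a `C¹` function of a function which is locally Lipschitz on an open set
containing the support of the cutoff. -/
lemma locallyLipschitz_mul_comp {E : Type*} [NormedAddCommGroup E] [NormedSpace ℝ E] {S : Set E}
    (hS : IsOpen S) {φ u : E → ℝ} {k : ℝ → ℝ} (hφ : ContDiff ℝ 1 φ) (hsupp : tsupport φ ⊆ S)
    (hu : LocallyLipschitzOn S u) (hk : ∀ z ∈ S, ContDiffAt ℝ 1 k (u z)) :
    LocallyLipschitz fun z => φ z * k (u z) := by
  intro z
  by_cases hz : z ∈ tsupport φ
  · obtain ⟨C, s, hs, hC⟩ := hu (hsupp hz)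
    rw [hS.nhdsWithin_eq (hsupp hz)] at hs
    have hcont : ContinuousAt u z := hu.continuousOn.continuousAt (hS.mem_nhds (hsupp hz))
    obtain ⟨K, t, ht, hK⟩ := (hk z (hsupp hz)).exists_lipschitzOnWith
    obtain ⟨C', s', hs', hC'⟩ := hφ.locallyLipschitz z
    have hm : ContDiffAt ℝ 1 (fun w : ℝ × ℝ => w.1 * w.2) (φ z, k (u z)) :=
      contDiff_mul.contDiffAt
    obtain ⟨K', t', ht', hK'⟩ := hm.exists_lipschitzOnWith
    have hku : ContinuousAt (fun z => (φ z, k (u z))) z :=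
      hφ.continuous.continuousAt.prodMk
        (ContinuousAt.comp (hk z (hsupp hz)).continuousAt hcont)
    refine ⟨K' * max C' (K * C), s ∩ u ⁻¹' t ∩ s' ∩ (fun z => (φ z, k (u z))) ⁻¹' t',
      Filter.inter_mem (Filter.inter_mem (Filter.inter_mem hs (hcont ht)) hs') (hku ht'), ?_⟩
    have h1 : LipschitzOnWith (K * C) (fun z => k (u z)) (s ∩ u ⁻¹' t) :=
      hK.comp (hC.mono inter_subset_left) fun x hx => hx.2
    exact hK'.comp ((hC'.mono (fun x hx => hx.1.2)).prodMk (h1.mono fun x hx => hx.1.1))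
      fun x hx => hx.2
  · refine ⟨0, (tsupport φ)ᶜ, (isClosed_tsupport φ).isOpen_compl.mem_nhds hz, ?_⟩
    intro x hx y hy
    simp [image_eq_zero_of_notMem_tsupport hx, image_eq_zero_of_notMem_tsupport hy]

/-- Integration by parts in time against the time-independent weight `a`. -/
lemma integral_time_deriv_eq_zero {a : Euc N → ℝ} (haLip : LocallyLipschitz a)
    (ha0 : ∀ x, 0 ≤ a x) {g tg : Euc N × ℝ → ℝ} {L : Euc N × ℝ → (Euc N × ℝ) →L[ℝ] ℝ}
    (hg : LocallyLipschitz g) (hgc : HasCompactSupport g) (hgS : tsupport g ⊆ Sset N)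
    (hL : ∀ᵐ z ∂ (volume : Measure (Euc N × ℝ)), z ∈ Sset N → HasFDerivAt g (L z) z)
    (htg : ∀ z ∈ Sset N, tg z = L z (0, 1)) :
    ∫ z, tg z ∂ muS a = 0 := by
  have hameas : Measurable a := haLip.continuous.measurable
  rw [integral_muS_eq hameas ha0]
  set G : Euc N × ℝ → ℝ := fun z => a z.1 * g z with hG
  have hGlip : LocallyLipschitz G :=
    (haLip.comp LipschitzWith.prod_fst.locallyLipschitz).mul_real hg
  have hGc : HasCompactSupport G := hgc.mul_left
  obtain ⟨C, hC⟩ := exists_lipschitzWith_of_hasCompactSupport hGlip hGc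
  have hone : LipschitzWith 0 (fun _ : Euc N × ℝ => (1 : ℝ)) := LipschitzWith.const _
  have h := LipschitzWith.integral_lineDeriv_mul_eq (μ := (volume : Measure (Euc N × ℝ)))
    hone hC hGc ((0 : Euc N), (-1 : ℝ))
  have e1 : ∀ z : Euc N × ℝ, lineDeriv ℝ (fun _ : Euc N × ℝ => (1 : ℝ)) z (0, -1) = 0 := by
    intro z; simp [lineDeriv]
  simp only [e1, zero_mul, integral_zero, mul_one, Prod.neg_mk, neg_zero, neg_neg] at h
  rw [← integral_indicator isOpen_Sset.measurableSet, h]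
  refine integral_congr_ae ?_
  filter_upwards [hL] with z hz
  by_cases hzS : z ∈ Sset N
  · rw [indicator_of_mem hzS, htg z hzS]
    have h2 : HasLineDerivAt ℝ G (a z.1 * L z (0, 1)) z (0, 1) := by
      have := ((hz hzS).hasLineDerivAt (0, 1))
      unfold HasLineDerivAt at this ⊢
      simpa [hG] using this.const_mul (a z.1)
    exact h2.lineDeriv.symm
  · rw [indicator_of_notMem hzS]
    have h0 : G =ᶠ[𝓝 z] fun _ => 0 := by
      have : (tsupport g)ᶜ ∈ 𝓝 z :=
        (isClosed_tsupport g).isOpen_compl.mem_nhds fun h => hzS (hgS h)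
      filter_upwards [this] with y hy
      simp [hG, image_eq_zero_of_notMem_tsupport hy]
    have h3 : HasFDerivAt G (0 : (Euc N × ℝ) →L[ℝ] ℝ) z :=
      (hasFDerivAt_const (0 : ℝ) z).congr_of_eventuallyEq h0
    exact ((h3.hasLineDerivAt (0, 1)).lineDeriv).symm

@[simp] lemma pairCLM_apply (v : Euc N) (c : ℝ) (w : Euc N × ℝ) :
    pairCLM v c w = ⟪v, w.1⟫ + c * w.2 := by
  simp [pairCLM]

lemma norm_fst_le_norm_pairCLM (v : Euc N) (c : ℝ) : ‖v‖ ≤ ‖pairCLM v c‖ := by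
  by_cases hv : v = 0
  · simp [hv]
  have h := (pairCLM v c).le_opNorm (v, 0)
  have hv' : 0 < ‖v‖ := norm_pos_iff.2 hv
  simp only [pairCLM_apply, mul_zero, add_zero, real_inner_self_eq_norm_sq, norm_pow, norm_norm,
    Prod.norm_mk, norm_zero, hv'.le, sup_of_le_left] at h
  rw [sq] at h
  exact le_of_mul_le_mul_right h hv'

lemma abs_snd_le_norm_pairCLM (v : Euc N) (c : ℝ) : |c| ≤ ‖pairCLM v c‖ := by
  simpa using (pairCLM v c).le_opNorm (0, 1)

/-- Rademacher's theorem for locally Lipschitz functions on an open set. -/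
lemma ae_differentiableAt_of_locallyLipschitzOn {E : Type*} [NormedAddCommGroup E]
    [NormedSpace ℝ E] [FiniteDimensional ℝ E] [MeasurableSpace E] [BorelSpace E] {μ : Measure E}
    [μ.IsAddHaarMeasure] {S : Set E} (hS : IsOpen S) {u : E → ℝ} (hu : LocallyLipschitzOn S u) :
    ∀ᵐ z ∂μ, z ∈ S → DifferentiableAt ℝ u z := by
  rw [ae_iff]
  refine measure_null_of_locally_null _ fun x hx => ?_
  simp only [mem_ofPred_eq, Classical.not_imp] at hx
  obtain ⟨C, s, hs, hC⟩ := hu hx.1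
  rw [hS.nhdsWithin_eq hx.1] at hs
  refine ⟨_, inter_mem_nhdsWithin _ (interior_mem_nhds.2 hs), ?_⟩
  have h := (hC.mono interior_subset).ae_differentiableWithinAt_of_mem (μ := μ)
  rw [ae_iff] at h
  refine measure_mono_null ?_ h
  rintro y ⟨hy1, hy2⟩
  simp only [mem_ofPred_eq, Classical.not_imp] at hy1 ⊢
  exact ⟨hy2, fun h => hy1.2 (h.differentiableAt (isOpen_interior.mem_nhds hy2))⟩

lemma exists_norm_fderiv_le_of_locallyLipschitzOn {E : Type*} [NormedAddCommGroup E]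
    [NormedSpace ℝ E] [FiniteDimensional ℝ E] {S K : Set E} (hS : IsOpen S) {u : E → ℝ}
    (hu : LocallyLipschitzOn S u) (hK : IsCompact K) (hKS : K ⊆ S) :
    ∃ C : ℝ, 0 ≤ C ∧ ∀ z ∈ K, ‖fderiv ℝ u z‖ ≤ C := by
  have : ProperSpace E := FiniteDimensional.proper ℝ E
  obtain ⟨δ, hδ, hsub⟩ := hK.exists_cthickening_subset_open hS hKS
  obtain ⟨C, hC⟩ := (hu.mono hsub).exists_lipschitzOnWith_of_compact hK.cthickening
  refine ⟨C, C.coe_nonneg, fun z hz => norm_fderiv_le_of_lipschitzOn ℝ ?_ hC⟩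
  exact Filter.mem_of_superset (isOpen_thickening.mem_nhds (self_subset_thickening hδ _ hz))
    (thickening_subset_cthickening _ _)

section WeakSol

variable {p m q : ℝ} {V : Euc N × ℝ → ℝ} {f : ℝ → ℝ} {a : Euc N → ℝ} {u : Euc N × ℝ → ℝ}
  {gu : Euc N × ℝ → Euc N} {ut : Euc N × ℝ → ℝ}

lemma IsWeakSol.ae_hasFDerivAt (hu : IsWeakSol N p m q V f a u gu ut) :
    ∀ᵐ z ∂ (volume : Measure (Euc N × ℝ)), z ∈ Sset N →
      HasFDerivAt u (pairCLM (gu z) (ut z)) z := by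
  have h1 := hu.deriv_ae
  rw [ae_restrict_iff' isOpen_Sset.measurableSet] at h1
  filter_upwards [h1, ae_differentiableAt_of_locallyLipschitzOn isOpen_Sset hu.locLip]
    with z hz1 hz2 hz
  exact hz1 hz (hz2 hz)

lemma IsWeakSol.ae_hasFDerivAt_muS (hu : IsWeakSol N p m q V f a u gu ut) (ha : Measurable a) :
    ∀ᵐ z ∂ muS a, HasFDerivAt u (pairCLM (gu z) (ut z)) z :=
  (muS_absolutelyContinuous ha).ae_le
    ((ae_restrict_iff' isOpen_Sset.measurableSet).2 hu.ae_hasFDerivAt)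

lemma IsWeakSol.aemeasurable_gu (hu : IsWeakSol N p m q V f a u gu ut) (ha : Measurable a) :
    AEMeasurable gu (muS a) := by
  refine ⟨fun z => (InnerProductSpace.toDual ℝ (Euc N)).symm
    ((fderiv ℝ u z).comp (ContinuousLinearMap.inl ℝ (Euc N) ℝ)), ?_, ?_⟩
  · have h1 : Measurable (fderiv ℝ u) := measurable_fderiv ℝ u
    have h2 : Continuous fun L : (Euc N × ℝ) →L[ℝ] ℝ =>
        (InnerProductSpace.toDual ℝ (Euc N)).symm
          (L.comp (ContinuousLinearMap.inl ℝ (Euc N) ℝ)) :=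
      (LinearIsometryEquiv.continuous _).comp (by fun_prop)
    exact h2.measurable.comp h1
  · filter_upwards [hu.ae_hasFDerivAt_muS ha] with z hz
    rw [hz.fderiv, eq_comm, LinearIsometryEquiv.symm_apply_eq]
    ext w
    simp

lemma IsWeakSol.aemeasurable_ut (hu : IsWeakSol N p m q V f a u gu ut) (ha : Measurable a) :
    AEMeasurable ut (muS a) := by
  refine ⟨fun z => fderiv ℝ u z (0, 1), measurable_fderiv_apply_const ℝ u (0, 1), ?_⟩
  filter_upwards [hu.ae_hasFDerivAt_muS ha] with z hz
  simp [hz.fderiv]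

lemma IsWeakSol.exists_bound (hu : IsWeakSol N p m q V f a u gu ut) (ha : Measurable a)
    {K : Set (Euc N × ℝ)} (hK : IsCompact K) (hKS : K ⊆ Sset N) :
    ∃ C : ℝ, 0 ≤ C ∧ ∀ᵐ z ∂ muS a, z ∈ K → ‖gu z‖ ≤ C ∧ |ut z| ≤ C := by
  obtain ⟨C, hC0, hC⟩ := exists_norm_fderiv_le_of_locallyLipschitzOn isOpen_Sset hu.locLip hK hKS
  refine ⟨C, hC0, ?_⟩
  filter_upwards [hu.ae_hasFDerivAt_muS ha] with z hz hzK
  have := hC z hzK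
  rw [hz.fderiv] at this
  exact ⟨(norm_fst_le_norm_pairCLM _ _).trans this, (abs_snd_le_norm_pairCLM _ _).trans this⟩

lemma aestronglyMeasurable_of_continuousOn (ha : Measurable a) {B : Euc N × ℝ → ℝ}
    (hB : ContinuousOn B (Sset N)) : AEStronglyMeasurable B (muS a) :=
  (hB.aestronglyMeasurable isOpen_Sset.measurableSet).mono_ac (muS_absolutelyContinuous ha)

lemma integrable_mul_of_continuousOn (ha : Measurable a) {Ca : ℝ} (hCa : ∀ x, |a x| ≤ Ca)
    {K : Set (Euc N × ℝ)} (hK : IsCompact K) (hKS : K ⊆ Sset N) {B w : Euc N × ℝ → ℝ}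
    (hB : ContinuousOn B (Sset N)) (hB0 : ∀ z, z ∉ K → B z = 0)
    (hw : AEMeasurable w (muS a)) {C : ℝ} (hwC : ∀ᵐ z ∂ muS a, z ∈ K → |w z| ≤ C) :
    Integrable (fun z => B z * w z) (muS a) := by
  obtain ⟨M, hM⟩ := hK.exists_bound_of_continuousOn (hB.mono hKS)
  have hon : IntegrableOn (fun z => B z * w z) K (muS a) := by
    refine IntegrableOn.of_bound (muS_compact_lt_top hCa hK)
      ((aestronglyMeasurable_of_continuousOn ha hB).mul hw.aestronglyMeasurable).restrict
      (M * C) ?_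
    rw [ae_restrict_iff' hK.measurableSet]
    filter_upwards [hwC] with z hz hzK
    rw [norm_mul]
    have h1 := hM z hzK
    exact mul_le_mul h1 (hz hzK) (norm_nonneg _) ((norm_nonneg _).trans h1)
  refine (integrableOn_iff_integrable_of_support_subset ?_).1 hon
  intro z hz
  by_contra hzK
  exact hz (by simp [hB0 z hzK])

lemma eq_zero_of_notMem_tsupport {φ : Euc N × ℝ → ℝ} {z : Euc N × ℝ} {v : Euc N} {c : ℝ}
    (hφ : HasFDerivAt φ (pairCLM v c) z) (hz : z ∉ tsupport φ) : φ z = 0 ∧ v = 0 ∧ c = 0 := by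
  have h0 : φ =ᶠ[𝓝 z] fun _ => 0 := by
    filter_upwards [(isClosed_tsupport φ).isOpen_compl.mem_nhds hz] with y hy
    exact image_eq_zero_of_notMem_tsupport hy
  have h1 : HasFDerivAt φ (0 : (Euc N × ℝ) →L[ℝ] ℝ) z :=
    (hasFDerivAt_const (0 : ℝ) z).congr_of_eventuallyEq h0
  have h2 := hφ.unique h1
  have h3 := norm_fst_le_norm_pairCLM v c
  have h4 := abs_snd_le_norm_pairCLM v c
  rw [h2, norm_zero] at h3 h4
  exact ⟨h0.self_of_nhds, by simpa using h3, by simpa using h4⟩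

/-- The inequality obtained by testing with `φ · h(u)`, with the time derivative integrated by
parts; `H` is a primitive of `h`. -/
lemma IsWeakSol.energy_inequality {σ c : ℝ}
    (hu : IsWeakSol N p (σ + 1) q (fun _ => 1) (fun _ => c) a u gu ut) (hp : 1 < p) (hσ : 0 ≤ σ)
    (hq : 0 ≤ q)
    (haLip : LocallyLipschitz a) (ha0 : ∀ x, 0 ≤ a x) {Ca : ℝ} (hCa : ∀ x, |a x| ≤ Ca)
    {φ tφ : Euc N × ℝ → ℝ} {gφ : Euc N × ℝ → Euc N} (hφ0 : ∀ z, 0 ≤ φ z)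
    (hφ : ∀ z, HasFDerivAt φ (pairCLM (gφ z) (tφ z)) z) (hgφ : Continuous gφ)
    (htφ : Continuous tφ) (hφc : HasCompactSupport φ) (hφS : tsupport φ ⊆ Sset N)
    {h H g : ℝ → ℝ} (hh0 : ∀ r, 0 ≤ r → 0 ≤ h r)
    (hh : ∀ r, 0 ≤ r → HasDerivAt h (-g r) r) (hH : ∀ r, 0 ≤ r → HasDerivAt H (h r) r)
    (hhC : ∀ r, 0 ≤ r → ContDiffAt ℝ 1 h r) (hHC : ∀ r, 0 ≤ r → ContDiffAt ℝ 1 H r)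
    (hgC : ContinuousOn g (Ici 0)) :
    Integrable (fun z => φ z * h (u z) * u z ^ q) (muS a) ∧
    Integrable (fun z => (⟪h (u z) • gφ z + (-(φ z * g (u z))) • gu z, gu z⟫ * u z ^ σ *
      ‖gu z‖ ^ (p - 2) * c) - tφ z * H (u z)) (muS a) ∧
    ∫ z, φ z * h (u z) * u z ^ q ∂ muS a ≤
      ∫ z, ((⟪h (u z) • gφ z + (-(φ z * g (u z))) • gu z, gu z⟫ * u z ^ σ *
        ‖gu z‖ ^ (p - 2) * c) - tφ z * H (u z)) ∂ muS a := by
  have ha : Measurable a := haLip.continuous.measurable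
  set K := tsupport φ with hKdef
  have hK : IsCompact K := hφc.isCompact
  obtain ⟨C, hC0, hC⟩ := hu.exists_bound ha hK hφS
  have hu0 : ∀ z ∈ Sset N, 0 ≤ u z := hu.nonneg
  have huc : ContinuousOn u (Sset N) := hu.locLip.continuousOn
  have hφcont : Continuous φ := continuous_iff_continuousAt.2 fun z => (hφ z).continuousAt
  have hpair : Continuous fun z => pairCLM (gφ z) (tφ z) := by
    unfold pairCLM
    fun_prop
  have hφC1 : ContDiff ℝ 1 φ := contDiff_one_iff_hasFDerivAt.2 ⟨_, hpair, hφ⟩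
  have hoff : ∀ z, z ∉ K → φ z = 0 ∧ gφ z = 0 ∧ tφ z = 0 :=
    fun z hz => eq_zero_of_notMem_tsupport (hφ z) hz
  have hhu : ContinuousOn (fun z => h (u z)) (Sset N) := fun z hz =>
    ((hhC _ (hu0 z hz)).continuousAt).comp_continuousWithinAt (huc z hz)
  have hHu : ContinuousOn (fun z => H (u z)) (Sset N) := fun z hz =>
    ((hHC _ (hu0 z hz)).continuousAt).comp_continuousWithinAt (huc z hz)
  have hguu : ContinuousOn (fun z => g (u z)) (Sset N) := hgC.comp huc hu0
  have hgumeas := hu.aemeasurable_gu ha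
  have hutmeas := hu.aemeasurable_ut ha
  have huq : ContinuousOn (fun z => u z ^ q) (Sset N) := huc.rpow_const fun z _ => Or.inr hq
  have huσ : ContinuousOn (fun z => u z ^ σ) (Sset N) := huc.rpow_const fun z _ => Or.inr hσ
  have hone : ∀ᵐ z ∂ muS a, z ∈ K → |(1 : ℝ)| ≤ 1 := by simp
  have hpow : ∀ᵐ z ∂ muS a, z ∈ K → |‖gu z‖ ^ (p - 1)| ≤ C ^ (p - 1) := by
    filter_upwards [hC] with z hz hzK
    rw [abs_of_nonneg (by positivity)]
    exact rpow_le_rpow (norm_nonneg _) (hz hzK).1 (by linarith)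
  have hpow' : ∀ᵐ z ∂ muS a, z ∈ K → |‖gu z‖ ^ p| ≤ C ^ p := by
    filter_upwards [hC] with z hz hzK
    rw [abs_of_nonneg (by positivity)]
    exact rpow_le_rpow (norm_nonneg _) (hz hzK).1 (by linarith)
  have I0 : Integrable (fun z => φ z * h (u z) * u z ^ q) (muS a) := by
    simpa using integrable_mul_of_continuousOn ha hCa hK hφS
      ((hφcont.continuousOn.mul hhu).mul huq) (fun z hz => by simp [(hoff z hz).1])
      (w := fun _ => 1) aemeasurable_const hone
  have I1' : Integrable (fun z => (‖gφ z‖ * h (u z) * u z ^ σ) * ‖gu z‖ ^ (p - 1)) (muS a) :=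
    integrable_mul_of_continuousOn ha hCa hK hφS
      ((hgφ.norm.continuousOn.mul hhu).mul huσ) (fun z hz => by simp [(hoff z hz).2.1])
      (by fun_prop) hpow
  have I2 : Integrable (fun z => (φ z * g (u z) * u z ^ σ) * ‖gu z‖ ^ p) (muS a) :=
    integrable_mul_of_continuousOn ha hCa hK hφS
      ((hφcont.continuousOn.mul hguu).mul huσ) (fun z hz => by simp [(hoff z hz).1])
      (by fun_prop) hpow'
  have I3 : Integrable (fun z => tφ z * H (u z)) (muS a) := by
    simpa using integrable_mul_of_continuousOn ha hCa hK hφS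
      (htφ.continuousOn.mul hHu) (fun z hz => by simp [(hoff z hz).2.2])
      (w := fun _ => 1) aemeasurable_const hone
  have I4 : Integrable (fun z => tφ z * h (u z) * u z) (muS a) := by
    simpa using integrable_mul_of_continuousOn ha hCa hK hφS
      ((htφ.continuousOn.mul hhu).mul huc) (fun z hz => by simp [(hoff z hz).2.2])
      (w := fun _ => 1) aemeasurable_const hone
  have I5 : Integrable (fun z => (φ z * g (u z) * u z) * ut z) (muS a) :=
    integrable_mul_of_continuousOn ha hCa hK hφS
      ((hφcont.continuousOn.mul hguu).mul huc) (fun z hz => by simp [(hoff z hz).1])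
      hutmeas (C := C) (by filter_upwards [hC] with z hz hzK using (hz hzK).2)
  have hrp : ∀ z, ‖gu z‖ * ‖gu z‖ ^ (p - 2) = ‖gu z‖ ^ (p - 1) := by
    intro z
    rcases eq_or_ne ‖gu z‖ 0 with h0 | h0
    · rw [h0, zero_rpow (by linarith : p - 1 ≠ 0)]; simp
    · have : 0 < ‖gu z‖ := lt_of_le_of_ne (norm_nonneg _) (Ne.symm h0)
      rw [mul_comm, ← rpow_add_one h0]; congr 1; ring
  have hrp' : ∀ z, ‖gu z‖ ^ 2 * ‖gu z‖ ^ (p - 2) = ‖gu z‖ ^ p := by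
    intro z
    rcases eq_or_ne ‖gu z‖ 0 with h0 | h0
    · rw [h0, zero_rpow (by linarith : p ≠ 0)]; simp
    · have : 0 < ‖gu z‖ := lt_of_le_of_ne (norm_nonneg _) (Ne.symm h0)
      rw [← rpow_two, ← rpow_add this]; congr 1; ring
  have I1 : Integrable (fun z => h (u z) * ⟪gφ z, gu z⟫ * u z ^ σ * ‖gu z‖ ^ (p - 2)) (muS a) := by
    refine I1'.mono' ?_ ?_
    · have m1 := (aestronglyMeasurable_of_continuousOn ha hhu).aemeasurable
      have m2 := (aestronglyMeasurable_of_continuousOn ha huσ).aemeasurable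
      have m3 : AEMeasurable (fun z => ⟪gφ z, gu z⟫) (muS a) :=
        hgφ.measurable.aemeasurable.inner hgumeas
      exact (((m1.mul m3).mul m2).mul (hgumeas.norm.pow_const _)).aestronglyMeasurable
    · filter_upwards [ae_mem_Sset ha] with z hz
      have h1 := hh0 _ (hu0 z hz)
      have h2 := rpow_nonneg (hu0 z hz) σ
      have h3 := rpow_nonneg (norm_nonneg (gu z)) (p - 2)
      rw [← hrp, norm_mul, norm_mul, norm_mul, norm_of_nonneg h1, norm_of_nonneg h2,
        norm_of_nonneg h3]
      calc h (u z) * ‖⟪gφ z, gu z⟫‖ * u z ^ σ * ‖gu z‖ ^ (p - 2)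
          ≤ h (u z) * (‖gφ z‖ * ‖gu z‖) * u z ^ σ * ‖gu z‖ ^ (p - 2) := by
            gcongr; exact norm_inner_le_norm _ _
        _ = _ := by ring
  have IA : Integrable (fun z => ⟪h (u z) • gφ z + (-(φ z * g (u z))) • gu z, gu z⟫ * u z ^ σ *
      ‖gu z‖ ^ (p - 2) * c) (muS a) := by
    refine ((I1.sub I2).mul_const c).congr (Eventually.of_forall fun z => ?_)
    simp only [Pi.sub_apply, inner_add_left, real_inner_smul_left, real_inner_self_eq_norm_sq]
    rw [← hrp']
    ring
  refine ⟨I0, IA.sub I3, ?_⟩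
  have hψderiv : ∀ z, HasFDerivAt u (pairCLM (gu z) (ut z)) z → z ∈ Sset N →
      HasFDerivAt (fun z => φ z * h (u z)) (pairCLM (h (u z) • gφ z + (-(φ z * g (u z))) • gu z)
        (h (u z) * tφ z + -(φ z * g (u z)) * ut z)) z := by
    intro z hz hzS
    have h1 := (hφ z).mul ((hh _ (hu0 z hzS)).comp_hasFDerivAt z hz)
    refine h1.congr_fderiv ?_
    ext <;> simp [inner_add_left, real_inner_smul_left] <;> ring
  have hweak := hu.weak_ineq (fun z => φ z * h (u z))
    (fun z => h (u z) • gφ z + (-(φ z * g (u z))) • gu z)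
    (fun z => h (u z) * tφ z + -(φ z * g (u z)) * ut z) ?_ ?_ ?_ ?_ ?_
  rotate_left
  · intro z
    by_cases hz : z ∈ K
    · exact mul_nonneg (hφ0 z) (hh0 _ (hu0 z (hφS hz)))
    · simp [(hoff z hz).1]
  · exact locallyLipschitz_mul_comp isOpen_Sset hφC1 hφS hu.locLip fun z hz => hhC _ (hu0 z hz)
  · exact hφc.mul_right
  · exact (tsupport_mul_subset_left).trans hφS
  · filter_upwards [hu.ae_hasFDerivAt] with z hz _
    by_cases hzK : z ∈ K
    · exact hψderiv z (hz (hφS hzK)) (hφS hzK)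
    · obtain ⟨e1, e2, e3⟩ := hoff z hzK
      have h0 : (fun z => φ z * h (u z)) =ᶠ[𝓝 z] fun _ => 0 := by
        filter_upwards [(isClosed_tsupport φ).isOpen_compl.mem_nhds hzK] with y hy
        simp [image_eq_zero_of_notMem_tsupport hy]
      refine ((hasFDerivAt_const (0 : ℝ) z).congr_of_eventuallyEq h0).congr_fderiv ?_
      ext <;> simp [e1, e2, e3]
  have hIBP : ∫ z, (tφ z * (h (u z) * u z - H (u z)) - φ z * g (u z) * u z * ut z) ∂ muS a = 0 := by
    refine integral_time_deriv_eq_zero haLip ha0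
      (g := fun z => φ z * (fun r => h r * r - H r) (u z))
      (L := fun z => pairCLM ((h (u z) * u z - H (u z)) • gφ z - (φ z * g (u z) * u z) • gu z)
        (tφ z * (h (u z) * u z - H (u z)) - φ z * g (u z) * u z * ut z)) ?_ hφc.mul_right
      ((tsupport_mul_subset_left).trans hφS) ?_ ?_
    · refine locallyLipschitz_mul_comp (k := fun r => h r * r - H r) isOpen_Sset hφC1 hφS
        hu.locLip fun z hz => ?_
      exact ((hhC _ (hu0 z hz)).mul contDiffAt_id).sub (hHC _ (hu0 z hz))
    · filter_upwards [hu.ae_hasFDerivAt] with z hz hzS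
      have hk : HasDerivAt (fun r => h r * r - H r) (-g (u z) * u z) (u z) := by
        have := ((hh _ (hu0 z hzS)).mul (hasDerivAt_id (u z))).sub (hH _ (hu0 z hzS))
        refine this.congr_deriv ?_
        simp
      have h1 := (hφ z).mul (hk.comp_hasFDerivAt z (hz hzS))
      refine h1.congr_fderiv ?_
      ext <;> simp [inner_sub_left, real_inner_smul_left] <;> ring
    · intro z _
      simp
  have hsplit : ∫ z, (h (u z) * tφ z + -(φ z * g (u z)) * ut z) * u z ∂ muS a =
      ∫ z, tφ z * H (u z) ∂ muS a := by
    have e : ∀ z, tφ z * (h (u z) * u z - H (u z)) - φ z * g (u z) * u z * ut z =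
        (tφ z * h (u z) * u z - (φ z * g (u z) * u z) * ut z) - tφ z * H (u z) := by
      intro z; ring
    simp_rw [e] at hIBP
    have I45 : Integrable (fun z => tφ z * h (u z) * u z - (φ z * g (u z) * u z) * ut z)
      (muS a) := I4.sub I5
    rw [integral_sub I45 I3, sub_eq_zero] at hIBP
    rw [← hIBP]
    congr 1 with z
    ring
  rw [integral_sub IA I3, ← hsplit]
  simpa only [mul_one, add_sub_cancel_right] using hweak

end WeakSol

section Profile

variable {ε s r : ℝ}

/-- The decreasing profile `(1 + (1 + r/ε)^(-s))/2`, with values in `[1/2, 1]` on `r ≥ 0`. -/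
def profile (ε s r : ℝ) : ℝ := 1 / 2 + 1 / 2 * (1 + r / ε) ^ (-s)

/-- The primitive of `profile` vanishing at `0`. -/
def profilePrim (ε s r : ℝ) : ℝ := r / 2 + ε / (2 * (1 - s)) * ((1 + r / ε) ^ (1 - s) - 1)

/-- Minus the derivative of `profile`. -/
def profileSlope (ε s r : ℝ) : ℝ := s / (2 * ε) * (1 + r / ε) ^ (-s - 1)

lemma one_le_one_add_div (hε : 0 < ε) (hr : 0 ≤ r) : 1 ≤ 1 + r / ε := by
  have : 0 ≤ r / ε := by positivity
  linarith

lemma half_le_profile (hε : 0 < ε) (hr : 0 ≤ r) : 1 / 2 ≤ profile ε s r := by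
  have := rpow_nonneg (zero_le_one.trans (one_le_one_add_div hε hr)) (-s)
  unfold profile; linarith

lemma profile_le_one (hε : 0 < ε) (hs : 0 < s) (hr : 0 ≤ r) : profile ε s r ≤ 1 := by
  have := rpow_le_one_of_one_le_of_nonpos (one_le_one_add_div hε hr) (by linarith : -s ≤ 0)
  unfold profile; linarith

lemma profileSlope_pos (hε : 0 < ε) (hs : 0 < s) (hr : 0 ≤ r) : 0 < profileSlope ε s r := by
  have := one_le_one_add_div hε hr
  unfold profileSlope; positivity

lemma hasDerivAt_one_add_div_rpow (hε : 0 < ε) (hr : 0 ≤ r) (e : ℝ) :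
    HasDerivAt (fun r => (1 + r / ε) ^ e) (1 / ε * e * (1 + r / ε) ^ (e - 1)) r := by
  have h1 := one_le_one_add_div hε hr
  have h2 : HasDerivAt (fun r : ℝ => 1 + r / ε) (1 / ε) r :=
    ((hasDerivAt_id r).div_const ε).const_add 1
  exact h2.rpow_const (Or.inl (by positivity))

lemma contDiffAt_one_add_div_rpow (hε : 0 < ε) (hr : 0 ≤ r) (e : ℝ) :
    ContDiffAt ℝ 1 (fun r => (1 + r / ε) ^ e) r := by
  have h1 := one_le_one_add_div hε hr
  refine ContDiffAt.rpow_const_of_ne ?_ (by positivity)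
  fun_prop

lemma hasDerivAt_profile (hε : 0 < ε) (hr : 0 ≤ r) :
    HasDerivAt (profile ε s) (-profileSlope ε s r) r := by
  have := ((hasDerivAt_one_add_div_rpow hε hr (-s)).const_mul (1 / 2)).const_add (1 / 2)
  refine this.congr_deriv ?_
  unfold profileSlope
  field_simp

lemma hasDerivAt_profilePrim (hε : 0 < ε) (hs : s < 1) (hr : 0 ≤ r) :
    HasDerivAt (profilePrim ε s) (profile ε s r) r := by
  have := ((hasDerivAt_id r).div_const 2).add
    (((hasDerivAt_one_add_div_rpow hε hr (1 - s)).sub_const 1).const_mul (ε / (2 * (1 - s))))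
  refine this.congr_deriv ?_
  have h1 : 1 - s ≠ 0 := by linarith
  unfold profile
  rw [show 1 - s - 1 = -s by ring]
  field_simp

lemma contDiffAt_profile (hε : 0 < ε) (hr : 0 ≤ r) : ContDiffAt ℝ 1 (profile ε s) r :=
  contDiffAt_const.add (contDiffAt_const.mul (contDiffAt_one_add_div_rpow hε hr _))

lemma contDiffAt_profilePrim (hε : 0 < ε) (hr : 0 ≤ r) : ContDiffAt ℝ 1 (profilePrim ε s) r :=
  (contDiffAt_id.div_const 2).add
    (contDiffAt_const.mul ((contDiffAt_one_add_div_rpow hε hr _).sub contDiffAt_const))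

lemma continuousOn_profileSlope (hε : 0 < ε) : ContinuousOn (profileSlope ε s) (Ici 0) :=
  fun _ hr => ((contDiffAt_one_add_div_rpow hε hr _).continuousAt.const_mul _).continuousWithinAt

lemma profilePrim_nonneg (hε : 0 < ε) (hs : s < 1) (hr : 0 ≤ r) : 0 ≤ profilePrim ε s r := by
  have h1 : 1 ≤ (1 + r / ε) ^ (1 - s) :=
    one_le_rpow (one_le_one_add_div hε hr) (by linarith)
  have h2 : 0 < 1 - s := by linarith
  have h3 : 0 ≤ (1 + r / ε) ^ (1 - s) - 1 := by linarith
  unfold profilePrim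
  positivity

lemma profilePrim_le (hε : 0 < ε) (hs0 : 0 < s) (hs : s < 1) (hr : 0 ≤ r) :
    profilePrim ε s r ≤ r := by
  have h2 : 0 < 1 - s := by linarith
  have h1 : (1 + r / ε) ^ (1 - s) ≤ 1 + (1 - s) * (r / ε) :=
    rpow_one_add_le_one_add_mul_self (by have : 0 ≤ r / ε := by positivity
                                         linarith) h2.le (by linarith)
  unfold profilePrim
  calc r / 2 + ε / (2 * (1 - s)) * ((1 + r / ε) ^ (1 - s) - 1)
      ≤ r / 2 + ε / (2 * (1 - s)) * ((1 - s) * (r / ε)) := by gcongr; linarith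
    _ = r := by field_simp; ring

end Profile

lemma mul_rpow_sub_one_le {b c p y : ℝ} (hb : 0 ≤ b) (hc : 0 < c) (hp : 1 < p) (hy : 0 ≤ y) :
    b * y ^ (p - 1) ≤ c * y ^ p + b ^ p * c ^ (1 - p) := by
  have hnn : 0 ≤ b ^ p * c ^ (1 - p) := by positivity
  have hnn' : 0 ≤ c * y ^ p := by positivity
  rcases le_or_gt b (c * y) with h | h
  · have : b * y ^ (p - 1) ≤ c * y ^ p := by
      calc b * y ^ (p - 1) ≤ c * y * y ^ (p - 1) := by gcongr
        _ = c * y ^ p := by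
          rcases hy.eq_or_lt with rfl | hy
          · simp [zero_rpow (by linarith : p ≠ 0)]
          · rw [rpow_sub_one hy.ne']; field_simp
    linarith
  · have hb' : 0 < b := lt_of_le_of_lt (by positivity) h
    have hyb : y ≤ b / c := by rw [le_div_iff₀ hc]; linarith
    have : b * y ^ (p - 1) ≤ b ^ p * c ^ (1 - p) := by
      calc b * y ^ (p - 1) ≤ b * (b / c) ^ (p - 1) := by gcongr
        _ = b ^ p * c ^ (1 - p) := by
          rw [div_rpow hb hc.le, rpow_sub_one hb'.ne', show 1 - p = -(p - 1) by ring,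
            rpow_neg hc.le]
          field_simp
    linarith

lemma exists_rpow_le_const_add_mul {α ω : ℝ} (h0 : 0 < α) (h1 : α < 1) (hω : 0 < ω) :
    ∃ M : ℝ, 0 ≤ M ∧ ∀ X : ℝ, 0 ≤ X → X ^ α ≤ ω + M * X := by
  refine ⟨ω ^ ((α - 1) / α), by positivity, fun X hX => ?_⟩
  have hM : 0 ≤ ω ^ ((α - 1) / α) * X := by positivity
  rcases le_or_gt X (ω ^ (1 / α)) with h | h
  · have : X ^ α ≤ ω := by
      calc X ^ α ≤ (ω ^ (1 / α)) ^ α := by gcongr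
        _ = ω := by rw [← rpow_mul hω.le, one_div_mul_cancel h0.ne', rpow_one]
    linarith
  · have hX' : 0 < X := lt_trans (by positivity) h
    have : X ^ α ≤ ω ^ ((α - 1) / α) * X := by
      calc X ^ α = X ^ (α - 1) * X := by rw [rpow_sub_one hX'.ne']; field_simp
        _ ≤ (ω ^ (1 / α)) ^ (α - 1) * X := by
          gcongr 1
          exact rpow_le_rpow_of_nonpos (by positivity) h.le (by linarith)
        _ = _ := by rw [← rpow_mul hω.le]; congr 2; ring
    linarith

lemma exists_rpow_le_mul_add_const {α ω : ℝ} (h0 : 0 < α) (h1 : α < 1) (hω : 0 < ω) :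
    ∃ M : ℝ, 0 ≤ M ∧ ∀ X : ℝ, 0 ≤ X → X ^ α ≤ M + ω * X := by
  refine ⟨(ω ^ (1 / (α - 1))) ^ α, by positivity, fun X hX => ?_⟩
  have hM : 0 ≤ ω * X := by positivity
  have hM' : 0 ≤ (ω ^ (1 / (α - 1))) ^ α := by positivity
  rcases le_or_gt X (ω ^ (1 / (α - 1))) with h | h
  · have : X ^ α ≤ (ω ^ (1 / (α - 1))) ^ α := by gcongr
    linarith
  · have hX' : 0 < X := lt_trans (by positivity) h
    have : X ^ α ≤ ω * X := by
      calc X ^ α = X ^ (α - 1) * X := by rw [rpow_sub_one hX'.ne']; field_simp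
        _ ≤ (ω ^ (1 / (α - 1))) ^ (α - 1) * X := by
          gcongr 1
          exact rpow_le_rpow_of_nonpos (by positivity) h.le (by linarith)
        _ = _ := by
          rw [← rpow_mul hω.le, one_div_mul_cancel (by linarith : α - 1 ≠ 0), rpow_one]
    linarith

/-- The nonlinearity, in rescaled variables, controlling the test-function error terms. -/
def errorTerm (p σ s q δ X : ℝ) : ℝ :=
  δ ^ (σ + (p - 1)) + δ ^ (-(s * (p - 1))) * X ^ ((σ + (s + 1) * (p - 1)) / q) + X ^ (1 / q)

lemma exists_errorTerm_le_const_add_mul {p σ s q M ω : ℝ} (hp : 1 < p) (hσ : 0 ≤ σ) (hs : 0 < s)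
    (hq : 1 < q) (hl : σ + (s + 1) * (p - 1) < q) (hM : 0 ≤ M) (hω : 0 < ω) :
    ∃ δ : ℝ, 0 < δ ∧ ∃ D : ℝ, 0 ≤ D ∧ ∀ X : ℝ, 0 ≤ X →
      M * errorTerm p σ s q δ X ≤ ω + D * X := by
  have hp' : 0 < p - 1 := by linarith
  set ω' := ω / (3 * (M + 1)) with hω'
  have hω'0 : 0 < ω' := by positivity
  have hexp : 0 < σ + (p - 1) := by linarith
  set δ := ω' ^ (1 / (σ + (p - 1))) with hδ
  have hδ0 : 0 < δ := by positivity
  have hδ1 : δ ^ (σ + (p - 1)) = ω' := by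
    rw [hδ, ← rpow_mul hω'0.le, one_div_mul_cancel hexp.ne', rpow_one]
  set d := δ ^ (-(s * (p - 1))) with hd
  have hd0 : 0 < d := by positivity
  have hl0 : 0 < σ + (s + 1) * (p - 1) := by positivity
  obtain ⟨M1, hM1, h1⟩ := exists_rpow_le_const_add_mul (α := (σ + (s + 1) * (p - 1)) / q)
    (by positivity) (by rw [div_lt_one (by linarith)]; exact hl) (ω := ω' / d) (by positivity)
  obtain ⟨M2, hM2, h2⟩ := exists_rpow_le_const_add_mul (α := 1 / q)
    (by positivity) (by rw [div_lt_one (by linarith)]; exact hq) hω'0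
  refine ⟨δ, hδ0, M * (d * M1 + M2), by positivity, fun X hX => ?_⟩
  unfold errorTerm
  rw [hδ1, ← hd]
  calc M * (ω' + d * X ^ ((σ + (s + 1) * (p - 1)) / q) + X ^ (1 / q))
      ≤ M * (ω' + d * (ω' / d + M1 * X) + (ω' + M2 * X)) := by
        gcongr
        · exact h1 X hX
        · exact h2 X hX
    _ = M * (3 * ω') + M * (d * M1 + M2) * X := by field_simp; ring
    _ ≤ ω + M * (d * M1 + M2) * X := by
        gcongr
        rw [hω']
        have : M * (3 * (ω / (3 * (M + 1)))) = ω * (M / (M + 1)) := by field_simp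
        rw [this]
        have : M / (M + 1) ≤ 1 := by rw [div_le_one (by linarith)]; linarith
        nlinarith

lemma exists_errorTerm_le_mul_add_const {p σ s q M : ℝ} (hp : 1 < p) (hσ : 0 ≤ σ) (hs : 0 < s)
    (hq : 1 < q) (hl : σ + (s + 1) * (p - 1) < q) (hM : 0 ≤ M) {ω : ℝ} (hω : 0 < ω) :
    ∃ A : ℝ, 0 ≤ A ∧ ∀ X : ℝ, 0 ≤ X → M * errorTerm p σ s q 1 X ≤ A + ω * X := by
  have hp' : 0 < p - 1 := by linarith
  have hl0 : 0 < σ + (s + 1) * (p - 1) := by positivity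
  set ω' := ω / (2 * (M + 1)) with hω'
  have hω'0 : 0 < ω' := by positivity
  obtain ⟨M1, hM1, h1⟩ := exists_rpow_le_mul_add_const (α := (σ + (s + 1) * (p - 1)) / q)
    (by positivity) (by rw [div_lt_one (by linarith)]; exact hl) hω'0
  obtain ⟨M2, hM2, h2⟩ := exists_rpow_le_mul_add_const (α := 1 / q)
    (by positivity) (by rw [div_lt_one (by linarith)]; exact hq) hω'0
  refine ⟨M * (1 + M1 + M2), by positivity, fun X hX => ?_⟩
  unfold errorTerm
  rw [one_rpow, one_rpow, one_mul]
  calc M * (1 + X ^ ((σ + (s + 1) * (p - 1)) / q) + X ^ (1 / q))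
      ≤ M * (1 + (M1 + ω' * X) + (M2 + ω' * X)) := by
        gcongr
        · exact h1 X hX
        · exact h2 X hX
    _ = M * (1 + M1 + M2) + M * (2 * ω') * X := by ring
    _ ≤ M * (1 + M1 + M2) + ω * X := by
        gcongr
        rw [hω']
        have : M * (2 * (ω / (2 * (M + 1)))) = ω * (M / (M + 1)) := by field_simp
        rw [this]
        have : M / (M + 1) ≤ 1 := by rw [div_le_one (by linarith)]; linarith
        nlinarith

lemma rpow_mul_one_add_rpow_le {δ U σ e r : ℝ} (hδ : 0 < δ) (hU : 0 ≤ U) (hσ : 0 ≤ σ) (hr : 0 ≤ r) :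
    U ^ σ * δ ^ e * (1 + U / δ) ^ r ≤ 2 ^ r * (δ ^ (σ + e) + δ ^ (e - r) * U ^ (σ + r)) := by
  rcases le_or_gt U δ with h | h
  · have h1 : 1 + U / δ ≤ 2 := by
      have := (div_le_one hδ).2 h
      linarith
    calc U ^ σ * δ ^ e * (1 + U / δ) ^ r ≤ δ ^ σ * δ ^ e * 2 ^ r := by gcongr
      _ = 2 ^ r * (δ ^ (σ + e) + 0) := by rw [rpow_add hδ]; ring
      _ ≤ _ := by gcongr; positivity
  · have hU' : 0 < U := hδ.trans h
    have h1 : 1 + U / δ ≤ 2 * (U / δ) := by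
      have := (one_le_div hδ).2 h.le
      linarith
    calc U ^ σ * δ ^ e * (1 + U / δ) ^ r ≤ U ^ σ * δ ^ e * (2 * (U / δ)) ^ r := by gcongr
      _ = 2 ^ r * (0 + δ ^ (e - r) * U ^ (σ + r)) := by
        rw [mul_rpow (by norm_num) (by positivity), div_rpow hU'.le hδ.le, rpow_add hU',
          rpow_sub hδ]
        ring
      _ ≤ _ := by gcongr; positivity

lemma gradient_terms_le {p σ s q δ T R B ζ u y : ℝ} {k : ℕ} (hp : 1 < p) (hσ : 0 ≤ σ)
    (hs : 0 < s) (hq : 0 < q) (hδ : 0 < δ) (hT : 0 < T) (hR : 0 < R) (hB : 0 ≤ B)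
    (hζ0 : 0 ≤ ζ) (hζ1 : ζ ≤ 1) (hu : 0 ≤ u) (hy : 0 ≤ y) (hk2 : 2 ≤ k)
    (hk : k * ((σ + (s + 1) * (p - 1)) / q) ≤ k - p)
    (hRT : R ^ p = T ^ (q - σ - (p - 1))) :
    k * ζ ^ (k - 1) * (B / R) * y ^ (p - 1) * u ^ σ
        - ζ ^ k * profileSlope (δ / T) s u * y ^ p * u ^ σ ≤
      T ^ (-q) * ((k * B) ^ p * (s / 2) ^ (1 - p) * 2 ^ ((s + 1) * (p - 1)) *
        (δ ^ (σ + (p - 1)) + δ ^ (-(s * (p - 1))) *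
          (ζ ^ k * (T * u) ^ q) ^ ((σ + (s + 1) * (p - 1)) / q))) := by
  rcases hζ0.eq_or_lt with rfl | hζ
  · have h1 : (0 : ℝ) ^ (k - 1) = 0 := zero_pow (by omega)
    have h2 : (0 : ℝ) ^ k = 0 := zero_pow (by omega)
    have h3 : 0 ≤ (0 * (T * u) ^ q) ^ ((σ + (s + 1) * (p - 1)) / q) :=
      rpow_nonneg (by simp) _
    rw [h1, h2]
    simp only [mul_zero, zero_mul, sub_zero]
    rw [zero_mul] at h3
    positivity
  have hp' : 0 < p - 1 := by linarith
  have hε : 0 < δ / T := by positivity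
  set g := profileSlope (δ / T) s u with hg
  have hg0 : 0 < g := profileSlope_pos hε hs hu
  have hbase := mul_rpow_sub_one_le (b := k * B / (R * ζ)) (c := g) (p := p) (y := y)
    (by positivity) hg0 hp hy
  set U := T * u with hU
  have hU0 : 0 ≤ U := by positivity
  have hv : 1 ≤ 1 + U / δ := one_le_one_add_div hδ hU0
  have hgv : g = (s / 2) * (T / δ) * (1 + U / δ) ^ (-(s + 1)) := by
    rw [hg, profileSlope, hU, show u / (δ / T) = T * u / δ by field_simp,
      show -s - 1 = -(s + 1) by ring]
    field_simp
  have hgp : g ^ (1 - p) = (s / 2) ^ (1 - p) * (T ^ (1 - p) * δ ^ (p - 1)) *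
      (1 + U / δ) ^ ((s + 1) * (p - 1)) := by
    rw [hgv, mul_rpow (by positivity) (by positivity), mul_rpow (by positivity) (by positivity),
      ← rpow_mul (by positivity), div_rpow hT.le hδ.le, show -(s + 1) * (1 - p) =
      (s + 1) * (p - 1) by ring, show δ ^ (1 - p) = (δ ^ (p - 1))⁻¹ by
      rw [← rpow_neg hδ.le]; congr 1; ring]
    field_simp
  have hbp : (k * B / (R * ζ)) ^ p = (k * B) ^ p * T ^ (-(q - σ - (p - 1))) * ζ ^ (-p) := by
    rw [div_rpow (by positivity) (by positivity), mul_rpow hR.le hζ.le, hRT, rpow_neg hT.le,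
      rpow_neg hζ.le]
    field_simp
  have huσ : u ^ σ = T ^ (-σ) * U ^ σ := by
    rw [hU, mul_rpow hT.le hu, ← mul_assoc, ← rpow_add hT]; simp
  have hTp : T ^ (-σ) * T ^ (-(q - σ - (p - 1))) * T ^ (1 - p) = T ^ (-q) := by
    rw [← rpow_add hT, ← rpow_add hT]; congr 1; ring
  have hζp : ζ ^ k * ζ ^ (-p) = ζ ^ ((k : ℝ) - p) := by
    rw [← rpow_natCast, ← rpow_add hζ]; congr 1
  have hζ1' : ζ ^ ((k : ℝ) - p) ≤ 1 := by
    refine rpow_le_one hζ0 hζ1 (le_trans ?_ hk); positivity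
  have hX : ζ ^ ((k : ℝ) - p) * U ^ (σ + (s + 1) * (p - 1)) ≤
      (ζ ^ k * U ^ q) ^ ((σ + (s + 1) * (p - 1)) / q) := by
    rw [mul_rpow (x := ζ ^ k) (y := U ^ q) (by positivity) (by positivity), ← rpow_mul hU0,
      mul_div_cancel₀ _ hq.ne',
      ← rpow_natCast, ← rpow_mul hζ0]
    gcongr 1
    exact rpow_le_rpow_of_exponent_ge hζ hζ1 hk
  have hmain := rpow_mul_one_add_rpow_le (σ := σ) (e := p - 1) (r := (s + 1) * (p - 1)) hδ hU0 hσ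
    (by positivity)
  rw [show p - 1 - (s + 1) * (p - 1) = -(s * (p - 1)) by ring] at hmain
  have hζk : ζ ^ k = ζ ^ (k - 1) * ζ := by
    rw [← pow_succ]; congr 1; omega
  calc k * ζ ^ (k - 1) * (B / R) * y ^ (p - 1) * u ^ σ - ζ ^ k * g * y ^ p * u ^ σ
      = ζ ^ k * u ^ σ * (k * B / (R * ζ) * y ^ (p - 1) - g * y ^ p) := by
        rw [hζk]; field_simp
    _ ≤ ζ ^ k * u ^ σ * ((k * B / (R * ζ)) ^ p * g ^ (1 - p)) := by
        gcongr; linarith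
    _ = (T ^ (-σ) * T ^ (-(q - σ - (p - 1))) * T ^ (1 - p)) *
        ((k * B) ^ p * (s / 2) ^ (1 - p) * ((ζ ^ k * ζ ^ (-p)) *
          (U ^ σ * δ ^ (p - 1) * (1 + U / δ) ^ ((s + 1) * (p - 1))))) := by
        rw [hbp, hgp, huσ]; ring
    _ ≤ T ^ (-q) * ((k * B) ^ p * (s / 2) ^ (1 - p) * (ζ ^ ((k : ℝ) - p) *
          (2 ^ ((s + 1) * (p - 1)) * (δ ^ (σ + (p - 1)) + δ ^ (-(s * (p - 1))) *
            U ^ (σ + (s + 1) * (p - 1)))))) := by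
        rw [hTp, hζp]; gcongr
    _ = T ^ (-q) * ((k * B) ^ p * (s / 2) ^ (1 - p) * 2 ^ ((s + 1) * (p - 1)) *
        (ζ ^ ((k : ℝ) - p) * δ ^ (σ + (p - 1)) + δ ^ (-(s * (p - 1))) *
          (ζ ^ ((k : ℝ) - p) * U ^ (σ + (s + 1) * (p - 1))))) := by ring
    _ ≤ _ := by
        gcongr
        exact mul_le_of_le_one_left (by positivity) hζ1'

lemma time_term_le {q T B ζ u : ℝ} {k : ℕ} (hq : 0 < q) (hT : 0 < T) (hB : 0 ≤ B)
    (hζ0 : 0 ≤ ζ) (hζ1 : ζ ≤ 1) (hu : 0 ≤ u) (hk2 : 2 ≤ k) (hk : k * (1 / q) ≤ k - 1) :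
    k * ζ ^ (k - 1) * (B / T ^ (q - 1)) * u ≤
      T ^ (-q) * (k * B * (ζ ^ k * (T * u) ^ q) ^ (1 / q)) := by
  have h1 : (ζ ^ k * (T * u) ^ q) ^ (1 / q) = ζ ^ ((k : ℝ) * (1 / q)) * (T * u) := by
    rw [mul_rpow (by positivity) (by positivity), ← rpow_mul (by positivity : 0 ≤ T * u),
      mul_one_div_cancel hq.ne', rpow_one, ← rpow_natCast, ← rpow_mul hζ0]
  have h2 : ζ ^ (k - 1) ≤ ζ ^ ((k : ℝ) * (1 / q)) := by
    rw [← rpow_natCast, Nat.cast_sub (by omega), Nat.cast_one]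
    rcases hζ0.eq_or_lt with rfl | hζ
    · have : (2 : ℝ) ≤ k := by exact_mod_cast hk2
      rw [zero_rpow (by linarith)]; positivity
    · exact rpow_le_rpow_of_exponent_ge hζ hζ1 hk
  have h3 : T ^ (q - 1) = T ^ q / T := rpow_sub_one hT.ne' q
  rw [h1, h3, rpow_neg hT.le]
  calc k * ζ ^ (k - 1) * (B / (T ^ q / T)) * u
      ≤ k * ζ ^ ((k : ℝ) * (1 / q)) * (B / (T ^ q / T)) * u := by gcongr
    _ = _ := by field_simp

/-- Pointwise control of the right-hand side of the energy inequality. -/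
lemma energy_integrand_le {p σ s q δ T R B c ζ χ u tφ : ℝ} {k : ℕ} {G gφ : Euc N} (hp : 1 < p)
    (hσ : 0 ≤ σ) (hs : 0 < s) (hs1 : s < 1) (hq : 0 < q) (hδ : 0 < δ) (hT : 0 < T) (hR : 0 < R)
    (hB : 0 ≤ B) (hc : 0 ≤ c) (hζ0 : 0 ≤ ζ) (hζ1 : ζ ≤ 1) (hχ0 : 0 ≤ χ) (hu : 0 ≤ u)
    (hk2 : 2 ≤ k) (hk : k * ((σ + (s + 1) * (p - 1)) / q) ≤ k - p) (hk' : k * (1 / q) ≤ k - 1)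
    (hRT : R ^ p = T ^ (q - σ - (p - 1)))
    (hgφ : ‖gφ‖ ≤ χ * (k * ζ ^ (k - 1) * (B / R)))
    (htφ : -tφ ≤ χ * (k * ζ ^ (k - 1) * (B / T ^ (q - 1)))) :
    ⟪profile (δ / T) s u • gφ + (-(χ * ζ ^ k * profileSlope (δ / T) s u)) • G, G⟫ * u ^ σ *
        ‖G‖ ^ (p - 2) * c - tφ * profilePrim (δ / T) s u ≤
      T ^ (-q) * (χ * ((c * ((k * B) ^ p * (s / 2) ^ (1 - p) * 2 ^ ((s + 1) * (p - 1))) + k * B) *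
        errorTerm p σ s q δ (ζ ^ k * (T * u) ^ q))) := by
  have hε : 0 < δ / T := by positivity
  set g := profileSlope (δ / T) s u with hg
  set h := profile (δ / T) s u with hh
  set H := profilePrim (δ / T) s u with hH
  set X := ζ ^ k * (T * u) ^ q with hX
  have hX0 : 0 ≤ X := by positivity
  set C := (k * B) ^ p * (s / 2) ^ (1 - p) * 2 ^ ((s + 1) * (p - 1)) with hC
  have hC0 : 0 ≤ C := by positivity
  have hg0 : 0 < g := profileSlope_pos hε hs hu
  have hh1 : h ≤ 1 := profile_le_one hε hs hu
  have hh0 : 0 ≤ h := (by norm_num : (0 : ℝ) ≤ 1 / 2).trans (half_le_profile hε hu)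
  have hH0 : 0 ≤ H := profilePrim_nonneg hε hs1 hu
  have hH1 : H ≤ u := profilePrim_le hε hs hs1 hu
  have hpow : ‖G‖ * ‖G‖ ^ (p - 2) = ‖G‖ ^ (p - 1) := by
    rcases eq_or_ne ‖G‖ 0 with h0 | h0
    · rw [h0, zero_rpow (by linarith : p - 1 ≠ 0)]; simp
    · rw [mul_comm, ← rpow_add_one h0]; congr 1; ring
  have hpow' : ‖G‖ ^ 2 * ‖G‖ ^ (p - 2) = ‖G‖ ^ p := by
    rcases eq_or_ne ‖G‖ 0 with h0 | h0
    · rw [h0, zero_rpow (by linarith : p ≠ 0)]; simp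
    · have : 0 < ‖G‖ := lt_of_le_of_ne (norm_nonneg _) (Ne.symm h0)
      rw [← rpow_two, ← rpow_add this]; congr 1; ring
  have hgrad := gradient_terms_le hp hσ hs hq hδ hT hR hB hζ0 hζ1 hu (norm_nonneg G) hk2 hk hRT
  rw [← hg, ← hX, ← hC] at hgrad
  have htime := time_term_le hq hT hB hζ0 hζ1 hu hk2 hk'
  rw [← hX] at htime
  have hinner : ⟪h • gφ + (-(χ * ζ ^ k * g)) • G, G⟫ ≤
      χ * (k * ζ ^ (k - 1) * (B / R)) * ‖G‖ - χ * ζ ^ k * g * ‖G‖ ^ 2 := by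
    rw [inner_add_left, real_inner_smul_left, real_inner_smul_left, real_inner_self_eq_norm_sq]
    have h1 : ⟪gφ, G⟫ ≤ ‖gφ‖ * ‖G‖ := real_inner_le_norm _ _
    have h2 : h * ⟪gφ, G⟫ ≤ χ * (k * ζ ^ (k - 1) * (B / R)) * ‖G‖ := by
      calc h * ⟪gφ, G⟫ ≤ h * (‖gφ‖ * ‖G‖) := by gcongr
        _ ≤ 1 * (‖gφ‖ * ‖G‖) := by gcongr
        _ = ‖gφ‖ * ‖G‖ := one_mul _
        _ ≤ _ := by gcongr
    linarith
  have hA : ⟪h • gφ + (-(χ * ζ ^ k * g)) • G, G⟫ * u ^ σ * ‖G‖ ^ (p - 2) * c ≤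
      c * χ * (T ^ (-q) * (C * (δ ^ (σ + (p - 1)) + δ ^ (-(s * (p - 1))) *
          X ^ ((σ + (s + 1) * (p - 1)) / q)))) := by
    calc ⟪h • gφ + (-(χ * ζ ^ k * g)) • G, G⟫ * u ^ σ * ‖G‖ ^ (p - 2) * c
        ≤ (χ * (k * ζ ^ (k - 1) * (B / R)) * ‖G‖ - χ * ζ ^ k * g * ‖G‖ ^ 2) * u ^ σ *
            ‖G‖ ^ (p - 2) * c := by gcongr
      _ = c * χ * (k * ζ ^ (k - 1) * (B / R) * (‖G‖ * ‖G‖ ^ (p - 2)) * u ^ σ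
            - ζ ^ k * g * (‖G‖ ^ 2 * ‖G‖ ^ (p - 2)) * u ^ σ) := by ring
      _ ≤ _ := by
        rw [hpow, hpow']
        gcongr
  have hB' : -(tφ * H) ≤ χ * (T ^ (-q) * (k * B * X ^ (1 / q))) := by
    calc -(tφ * H) = -tφ * H := by ring
      _ ≤ χ * (k * ζ ^ (k - 1) * (B / T ^ (q - 1))) * H := by gcongr
      _ ≤ χ * (k * ζ ^ (k - 1) * (B / T ^ (q - 1))) * u := by gcongr
      _ = χ * (k * ζ ^ (k - 1) * (B / T ^ (q - 1)) * u) := by ring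
      _ ≤ _ := by gcongr
  set E1 := δ ^ (σ + (p - 1)) + δ ^ (-(s * (p - 1))) * X ^ ((σ + (s + 1) * (p - 1)) / q) with hE1
  have hE10 : 0 ≤ E1 := by positivity
  set E2 := X ^ (1 / q) with hE2
  have hE20 : 0 ≤ E2 := by positivity
  have hE : errorTerm p σ s q δ X = E1 + E2 := rfl
  rw [hE]
  have hTq : 0 ≤ T ^ (-q) := by positivity
  calc _ ≤ c * χ * (T ^ (-q) * (C * E1)) + χ * (T ^ (-q) * (k * B * E2)) := by linarith
    _ ≤ c * χ * (T ^ (-q) * (C * E1)) + χ * (T ^ (-q) * (k * B * E2)) +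
        (χ * (T ^ (-q) * (c * C * E2)) + χ * (T ^ (-q) * (k * B * E1))) := by
      refine le_add_of_nonneg_right ?_
      positivity
    _ = _ := by ring

/-- A space-time cutoff `χ * ζ ^ k`, where `χ` cuts off near `t = 0` and `ζ` at spatial scale `R`
and time scale `L`, with spatial gradient `gφ` and time derivative `tφ`. -/
structure IsCutoff (N k : ℕ) (B R L : ℝ) (χ ζ tφ : Euc N × ℝ → ℝ) (gφ : Euc N × ℝ → Euc N) :
    Prop where
  χ_nonneg : ∀ z, 0 ≤ χ z
  χ_le_one : ∀ z, χ z ≤ 1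
  ζ_nonneg : ∀ z, 0 ≤ ζ z
  ζ_le_one : ∀ z, ζ z ≤ 1
  hasFDerivAt : ∀ z, HasFDerivAt (fun z => χ z * ζ z ^ k) (pairCLM (gφ z) (tφ z)) z
  continuous_grad : Continuous gφ
  continuous_time : Continuous tφ
  tsupport_subset : tsupport (fun z => χ z * ζ z ^ k) ⊆
    closedBall (0 : Euc N) (2 * R) ×ˢ Icc R⁻¹ (2 * L)
  grad_le : ∀ z, ‖gφ z‖ ≤ χ z * (k * ζ z ^ (k - 1) * (B / R))
  neg_time_le : ∀ z, -tφ z ≤ χ z * (k * ζ z ^ (k - 1) * (B / L))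
  grad_eq_zero : ∀ z, ‖z.1‖ < R → |z.2| < L → gφ z = 0
  time_nonneg : ∀ z, ‖z.1‖ < R → |z.2| < L → 0 ≤ tφ z
  eq_one : ∀ z, ‖z.1‖ ≤ R → 2 * R⁻¹ ≤ z.2 → z.2 ≤ L → χ z * ζ z ^ k = 1

lemma exists_isCutoff (N : ℕ) {k : ℕ} (hk : k ≠ 0) : ∃ B : ℝ, 0 ≤ B ∧ ∀ R : ℝ, 0 < R → ∀ L : ℝ,
    0 < L → ∃ χ ζ tφ gφ, IsCutoff N k B R L χ ζ tφ gφ := by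
  let ρ : ContDiffBump (0 : Euc N) := ⟨1, 2, by norm_num, by norm_num⟩
  let τ : ContDiffBump (0 : ℝ) := ⟨1, 2, by norm_num, by norm_num⟩
  have hρ : ContDiff ℝ 1 ρ := ρ.contDiff
  have hτ : ContDiff ℝ 1 τ := τ.contDiff
  have hρd : Differentiable ℝ ρ := hρ.differentiable one_ne_zero
  have hτd : Differentiable ℝ τ := hτ.differentiable one_ne_zero
  have hρ' : Continuous (gradient ρ) :=
    (InnerProductSpace.toDual ℝ (Euc N)).symm.continuous.comp (hρ.continuous_fderiv one_ne_zero)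
  have hτ' : Continuous (deriv τ) := hτ.continuous_deriv le_rfl
  have hσ : ContDiff ℝ 1 smoothTransition := smoothTransition.contDiff
  have hσd : Differentiable ℝ smoothTransition := hσ.differentiable one_ne_zero
  have hσ' : Continuous (deriv smoothTransition) := hσ.continuous_deriv le_rfl
  have hmono : Monotone smoothTransition := smoothTransition.monotone
  obtain ⟨B₁, hB₁⟩ : ∃ B₁, ∀ x, ‖gradient ρ x‖ ≤ B₁ := by
    obtain ⟨C, hC⟩ := (ρ.hasCompactSupport.fderiv ℝ).exists_bound_of_continuous
      (hρ.continuous_fderiv one_ne_zero)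
    exact ⟨C, fun x => by rw [gradient, LinearIsometryEquiv.norm_map]; exact hC x⟩
  obtain ⟨B₂, hB₂⟩ : ∃ B₂, ∀ x, ‖deriv τ x‖ ≤ B₂ :=
    τ.hasCompactSupport.deriv.exists_bound_of_continuous hτ'
  have hB₁0 : 0 ≤ B₁ := (norm_nonneg _).trans (hB₁ 0)
  have hB₂0 : 0 ≤ B₂ := (norm_nonneg _).trans (hB₂ 0)
  refine ⟨B₁ + B₂, by positivity, fun R hR L hL => ?_⟩
  let χ : Euc N × ℝ → ℝ := fun z => smoothTransition (R * z.2 - 1)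
  let ζ : Euc N × ℝ → ℝ := fun z => ρ (R⁻¹ • z.1) * τ (L⁻¹ * z.2)
  let gζ : Euc N × ℝ → Euc N := fun z => (τ (L⁻¹ * z.2) * R⁻¹) • gradient ρ (R⁻¹ • z.1)
  let tζ : Euc N × ℝ → ℝ := fun z => ρ (R⁻¹ • z.1) * (deriv τ (L⁻¹ * z.2) * L⁻¹)
  let χ' : Euc N × ℝ → ℝ := fun z => deriv smoothTransition (R * z.2 - 1) * R
  have hχ0 : ∀ z, 0 ≤ χ z := fun z => smoothTransition.nonneg _
  have hχ1 : ∀ z, χ z ≤ 1 := fun z => smoothTransition.le_one _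
  have hχ'0 : ∀ z, 0 ≤ χ' z := fun z => mul_nonneg hmono.deriv_nonneg hR.le
  have hζ0 : ∀ z, 0 ≤ ζ z := fun z => mul_nonneg ρ.nonneg τ.nonneg
  have hζ1 : ∀ z, ζ z ≤ 1 := fun z => mul_le_one₀ ρ.le_one τ.nonneg τ.le_one
  have hζd : ∀ z, HasFDerivAt ζ (pairCLM (gζ z) (tζ z)) z := by
    intro z
    have h1 : HasFDerivAt (fun z : Euc N × ℝ => ρ (R⁻¹ • z.1)) _ z :=
      HasFDerivAt.comp (g := ρ) (f := fun z : Euc N × ℝ => R⁻¹ • z.1) z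
        (hρd (R⁻¹ • z.1)).hasGradientAt.hasFDerivAt ((hasFDerivAt_fst (p := z)).const_smul R⁻¹)
    have h2 : HasFDerivAt (fun z : Euc N × ℝ => τ (L⁻¹ * z.2)) _ z :=
      HasFDerivAt.comp (g := τ) (f := fun z : Euc N × ℝ => L⁻¹ * z.2) z
        (hτd (L⁻¹ * z.2)).hasDerivAt.hasFDerivAt ((hasFDerivAt_snd (p := z)).const_mul L⁻¹)
    refine (h1.mul h2).congr_fderiv ?_
    ext w
    · simp [gζ, tζ, inner_smul_left]; ring
    · simp [gζ, tζ, mul_comm]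
  have hχd : ∀ z, HasFDerivAt χ (pairCLM 0 (χ' z)) z := by
    intro z
    have h1 : HasFDerivAt χ _ z :=
      HasFDerivAt.comp (g := smoothTransition) (f := fun z : Euc N × ℝ => R * z.2 - 1) z
        (hσd (R * z.2 - 1)).hasDerivAt.hasFDerivAt
        (((hasFDerivAt_snd (p := z)).const_mul R).sub_const 1)
    refine h1.congr_fderiv ?_
    ext w
    · simp
    · simp [χ']; ring
  have hζc : Continuous ζ := by have := hρ.continuous; have := hτ.continuous; fun_prop
  have hχc : Continuous χ := by have := hσ.continuous; fun_prop
  have hgζ : ∀ z, ‖gζ z‖ ≤ (B₁ + B₂) / R := by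
    intro z
    rw [norm_smul, norm_mul, norm_of_nonneg τ.nonneg, norm_of_nonneg (by positivity),
      div_eq_inv_mul]
    calc τ (L⁻¹ * z.2) * R⁻¹ * ‖gradient ρ (R⁻¹ • z.1)‖ ≤ 1 * R⁻¹ * B₁ := by
          gcongr
          · exact τ.le_one
          · exact hB₁ _
      _ ≤ _ := by rw [one_mul]; gcongr; linarith
  have htζ : ∀ z, -tζ z ≤ (B₁ + B₂) / L := by
    intro z
    refine (neg_le_abs _).trans ?_
    rw [abs_mul, abs_mul, abs_of_nonneg ρ.nonneg, abs_of_nonneg (by positivity : 0 ≤ L⁻¹)]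
    calc ρ (R⁻¹ • z.1) * (|deriv τ (L⁻¹ * z.2)| * L⁻¹) ≤ 1 * (B₂ * L⁻¹) := by
          gcongr
          · exact ρ.le_one
          · exact hB₂ _
      _ ≤ _ := by rw [one_mul, div_eq_mul_inv]; gcongr; linarith
  have hinner : ∀ z : Euc N × ℝ, ‖z.1‖ < R → |z.2| < L → gζ z = 0 ∧ tζ z = 0 := by
    intro z h1 h2
    have h3 : R⁻¹ • z.1 ∈ ball (0 : Euc N) 1 := by
      rw [mem_ball_zero_iff, norm_smul, norm_of_nonneg (by positivity), inv_mul_lt_one₀ hR]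
      exact h1
    have h4 : L⁻¹ * z.2 ∈ ball (0 : ℝ) 1 := by
      rw [mem_ball_zero_iff, norm_mul, norm_of_nonneg (by positivity), inv_mul_lt_one₀ hL]
      exact h2
    have h5 : gradient ρ (R⁻¹ • z.1) = 0 := by
      rw [gradient, (ρ.eventuallyEq_one_of_mem_ball h3).fderiv_eq]
      simp
    have h6 : deriv τ (L⁻¹ * z.2) = 0 := by
      rw [(τ.eventuallyEq_one_of_mem_ball h4).deriv_eq]
      simp
    simp [gζ, tζ, h5, h6]
  refine ⟨χ, ζ, fun z => χ z * (k * ζ z ^ (k - 1) * tζ z) + ζ z ^ k * χ' z,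
    fun z => (χ z * (k * ζ z ^ (k - 1))) • gζ z, hχ0, hχ1, hζ0, hζ1, ?_, ?_, ?_, ?_, ?_, ?_, ?_,
    ?_, ?_⟩
  · intro z
    refine ((hχd z).mul ((hζd z).pow k)).congr_fderiv ?_
    ext w
    · simp [inner_smul_left]; ring
    · simp
  · have := hτ.continuous
    fun_prop
  · have := hρ.continuous
    fun_prop
  · refine closure_minimal (fun z hz => ?_) (isClosed_closedBall.prod isClosed_Icc)
    have h1 : χ z ≠ 0 := left_ne_zero_of_mul hz
    have h2 : ζ z ≠ 0 := fun h => hz (by simp [h, hk])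
    have h3 : R⁻¹ • z.1 ∈ ball (0 : Euc N) 2 := by
      rw [← show Function.support ρ = ball 0 2 from ρ.support_eq]
      exact left_ne_zero_of_mul h2
    have h4 : L⁻¹ * z.2 ∈ ball (0 : ℝ) 2 := by
      rw [← show Function.support τ = ball 0 2 from τ.support_eq]
      exact right_ne_zero_of_mul h2
    rw [mem_ball_zero_iff, norm_smul, norm_of_nonneg (by positivity), inv_mul_lt_iff₀ hR] at h3
    rw [mem_ball_zero_iff, norm_mul, norm_of_nonneg (by positivity), inv_mul_lt_iff₀ hL] at h4
    have h5 : 0 < R * z.2 - 1 := by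
      by_contra! h
      exact h1 (smoothTransition.zero_of_nonpos h)
    refine ⟨by rw [mem_closedBall_zero_iff]; linarith, ?_, ?_⟩
    · rw [inv_le_iff_one_le_mul₀' hR]; linarith
    · have := le_abs_self z.2
      rw [norm_eq_abs] at h4
      linarith
  · intro z
    rw [norm_smul, norm_of_nonneg (by have := hχ0 z; have := hζ0 z; positivity), mul_assoc]
    have := hχ0 z
    have := hζ0 z
    gcongr
    exact hgζ z
  · intro z
    have h1 := hχ0 z
    have h2 := hζ0 z
    have h3 := hχ'0 z
    calc -(χ z * (k * ζ z ^ (k - 1) * tζ z) + ζ z ^ k * χ' z)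
        = χ z * (k * ζ z ^ (k - 1) * -tζ z) - ζ z ^ k * χ' z := by ring
      _ ≤ χ z * (k * ζ z ^ (k - 1) * -tζ z) := sub_le_self _ (by positivity)
      _ ≤ _ := by
        gcongr
        exact htζ z
  · intro z h1 h2
    simp [(hinner z h1 h2).1]
  · intro z h1 h2
    simp only [(hinner z h1 h2).2, mul_zero, zero_add]
    exact mul_nonneg (pow_nonneg (hζ0 z) _) (hχ'0 z)
  · intro z h1 h2 h3
    have h0 : 0 ≤ z.2 := le_trans (by positivity) h2
    have h4 : χ z = 1 := smoothTransition.one_of_one_le (by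
      have := mul_le_mul_of_nonneg_left h2 hR.le
      rw [show R * (2 * R⁻¹) = 2 by field_simp] at this
      linarith)
    have h5 : ρ (R⁻¹ • z.1) = 1 := ρ.one_of_mem_closedBall (by
      rw [mem_closedBall_zero_iff, norm_smul, norm_of_nonneg (by positivity), inv_mul_le_one₀ hR]
      exact h1)
    have h6 : τ (L⁻¹ * z.2) = 1 := τ.one_of_mem_closedBall (by
      rw [mem_closedBall_zero_iff, norm_mul, norm_of_nonneg (by positivity), norm_of_nonneg h0,
        inv_mul_le_one₀ hL]
      exact h3)
    simp [ζ, h4, h5, h6]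

/-- The part of the cylinder `closedBall 0 (2 * R) ×ˢ Icc 0 (2 * L)` on which the spatial cutoff
varies. -/
def outerCylinder (N : ℕ) (R L : ℝ) : Set (Euc N × ℝ) :=
  (closedBall (0 : Euc N) (2 * R) ×ˢ Icc 0 (2 * L)) \ (ball (0 : Euc N) R ×ˢ Iio L)

lemma measurableSet_outerCylinder (R L : ℝ) : MeasurableSet (outerCylinder N R L) :=
  (measurableSet_closedBall.prod measurableSet_Icc).diff (measurableSet_ball.prod measurableSet_Iio)

lemma muS_outerCylinder_ne_top {a : Euc N → ℝ} {Ca : ℝ} (hCa : ∀ x, |a x| ≤ Ca) (R L : ℝ) :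
    muS a (outerCylinder N R L) ≠ ⊤ :=
  ((measure_mono sdiff_subset).trans_lt (muS_compact_lt_top hCa
    ((isCompact_closedBall (0 : Euc N) (2 * R)).prod isCompact_Icc))).ne

lemma IsCutoff.tsupport_subset_Sset {k : ℕ} {B R L : ℝ} {χ ζ tφ : Euc N × ℝ → ℝ}
    {gφ : Euc N × ℝ → Euc N} (h : IsCutoff N k B R L χ ζ tφ gφ) (hR : 0 < R) :
    tsupport (fun z => χ z * ζ z ^ k) ⊆ Sset N := fun _ hz =>
  (inv_pos.2 hR).trans_le (h.tsupport_subset hz).2.1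

lemma IsCutoff.hasCompactSupport {k : ℕ} {B R L : ℝ} {χ ζ tφ : Euc N × ℝ → ℝ}
    {gφ : Euc N × ℝ → Euc N} (h : IsCutoff N k B R L χ ζ tφ gφ) :
    HasCompactSupport (fun z => χ z * ζ z ^ k) :=
  ((isCompact_closedBall (0 : Euc N) (2 * R)).prod isCompact_Icc).of_isClosed_subset
    (isClosed_tsupport _) h.tsupport_subset

section Cutoff

variable {p q σ c Ca : ℝ} {a : Euc N → ℝ} {u ut : Euc N × ℝ → ℝ} {gu : Euc N × ℝ → Euc N} {k : ℕ}
  {B R L : ℝ} {χ ζ tφ : Euc N × ℝ → ℝ} {gφ : Euc N × ℝ → Euc N}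

lemma IsWeakSol.integrable_cutoff
    (hu : IsWeakSol N p (σ + 1) q (fun _ => 1) (fun _ => c) a u gu ut) (hp : 1 < p) (hσ : 0 ≤ σ)
    (hq : 0 ≤ q) (haLip : LocallyLipschitz a) (ha0 : ∀ x, 0 ≤ a x) (hCa : ∀ x, |a x| ≤ Ca)
    (h : IsCutoff N k B R L χ ζ tφ gφ) (hR : 0 < R) :
    Integrable (fun z => χ z * ζ z ^ k * u z ^ q) (muS a) := by
  have := (hu.energy_inequality hp hσ hq haLip ha0 hCa
    (fun z => mul_nonneg (h.χ_nonneg z) (pow_nonneg (h.ζ_nonneg z) k)) h.hasFDerivAt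
    h.continuous_grad h.continuous_time h.hasCompactSupport (h.tsupport_subset_Sset hR)
    (h := fun _ => 1) (H := id) (g := fun _ => 0) (fun _ _ => zero_le_one)
    (fun r _ => by simpa using hasDerivAt_const r (1 : ℝ)) (fun r _ => hasDerivAt_id r)
    (fun _ _ => contDiffAt_const) (fun _ _ => contDiffAt_id) continuousOn_const).1
  simpa using this

/-- The energy inequality for a cutoff, with all errors confined to `outerCylinder`. -/
lemma IsWeakSol.integral_cutoff_le
    (hu : IsWeakSol N p (σ + 1) q (fun _ => 1) (fun _ => c) a u gu ut) (hp : 1 < p) (hσ : 0 ≤ σ)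
    (hq : 0 < q) (hc : 0 ≤ c) (haLip : LocallyLipschitz a) (ha0 : ∀ x, 0 ≤ a x)
    (hCa : ∀ x, |a x| ≤ Ca) {s δ T A D : ℝ} (hs : 0 < s) (hs1 : s < 1) (hδ : 0 < δ) (hT : 0 < T)
    (hR : 0 < R) (hB : 0 ≤ B) (hk2 : 2 ≤ k)
    (hk : k * ((σ + (s + 1) * (p - 1)) / q) ≤ k - p) (hk' : k * (1 / q) ≤ k - 1)
    (hRT : R ^ p = T ^ (q - σ - (p - 1))) (h : IsCutoff N k B R (T ^ (q - 1)) χ ζ tφ gφ)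
    (hA : 0 ≤ A)
    (hAD : ∀ X : ℝ, 0 ≤ X →
      (c * ((k * B) ^ p * (s / 2) ^ (1 - p) * 2 ^ ((s + 1) * (p - 1))) + k * B) *
        errorTerm p σ s q δ X ≤ A + D * X) :
    1 / 2 * ∫ z, χ z * ζ z ^ k * u z ^ q ∂ muS a ≤
      A * (T ^ (-q) * (muS a).real (outerCylinder N R (T ^ (q - 1)))) +
        D * ∫ z in outerCylinder N R (T ^ (q - 1)), χ z * ζ z ^ k * u z ^ q ∂ muS a := by
  have ha : Measurable a := haLip.continuous.measurable
  have hε : 0 < δ / T := by positivity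
  set W := outerCylinder N R (T ^ (q - 1)) with hWdef
  have hW : MeasurableSet W := measurableSet_outerCylinder _ _
  have hWtop : muS a W ≠ ⊤ := muS_outerCylinder_ne_top hCa _ _
  have hφ0 : ∀ z, 0 ≤ χ z * ζ z ^ k := fun z =>
    mul_nonneg (h.χ_nonneg z) (pow_nonneg (h.ζ_nonneg z) k)
  have hint := hu.integrable_cutoff hp hσ hq.le haLip ha0 hCa h hR
  obtain ⟨I0, I1, hle⟩ := hu.energy_inequality hp hσ hq.le haLip ha0 hCa hφ0 h.hasFDerivAt
    h.continuous_grad h.continuous_time h.hasCompactSupport (h.tsupport_subset_Sset hR)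
    (h := profile (δ / T) s) (H := profilePrim (δ / T) s) (g := profileSlope (δ / T) s)
    (fun r hr => le_trans (by norm_num) (half_le_profile hε hr))
    (fun r hr => hasDerivAt_profile hε hr) (fun r hr => hasDerivAt_profilePrim hε hs1 hr)
    (fun r hr => contDiffAt_profile hε hr) (fun r hr => contDiffAt_profilePrim hε hr)
    (continuousOn_profileSlope hε)
  have hS := ae_mem_Sset (N := N) ha
  have hhalf : 1 / 2 * ∫ z, χ z * ζ z ^ k * u z ^ q ∂ muS a ≤
      ∫ z, χ z * ζ z ^ k * profile (δ / T) s (u z) * u z ^ q ∂ muS a := by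
    rw [← integral_const_mul]
    refine integral_mono_ae (hint.const_mul _) I0 ?_
    filter_upwards [hS] with z hz
    have h1 := half_le_profile (s := s) hε (hu.nonneg z hz)
    have h2 : 0 ≤ χ z * ζ z ^ k * u z ^ q := mul_nonneg (hφ0 z) (rpow_nonneg (hu.nonneg z hz) q)
    calc 1 / 2 * (χ z * ζ z ^ k * u z ^ q)
        ≤ profile (δ / T) s (u z) * (χ z * ζ z ^ k * u z ^ q) := by gcongr
      _ = _ := by ring
  have hcW : IntegrableOn (fun _ => A * T ^ (-q)) W (muS a) := integrableOn_const hWtop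
  have hIW : Integrable (W.indicator fun z => A * T ^ (-q) + D * (χ z * ζ z ^ k * u z ^ q))
      (muS a) :=
    IntegrableOn.integrable_indicator
      (hcW.add (hint.const_mul D).integrableOn) hW
  refine (hhalf.trans hle).trans ((integral_mono_ae I1 hIW ?_).trans_eq ?_)
  · filter_upwards [hS] with z hz
    have hu0 := hu.nonneg z hz
    by_cases hzW : z ∈ W
    · rw [indicator_of_mem hzW]
      have hζ0 := h.ζ_nonneg z
      have hχ0 := h.χ_nonneg z
      have hTu : T ^ (-q) * (ζ z ^ k * (T * u z) ^ q) = ζ z ^ k * u z ^ q := by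
        rw [mul_rpow hT.le hu0, rpow_neg hT.le]
        field_simp
      calc _ ≤ T ^ (-q) * (χ z * ((c * ((k * B) ^ p * (s / 2) ^ (1 - p) *
              2 ^ ((s + 1) * (p - 1))) + k * B) *
              errorTerm p σ s q δ (ζ z ^ k * (T * u z) ^ q))) :=
            energy_integrand_le hp hσ hs hs1 hq hδ hT hR hB hc hζ0 (h.ζ_le_one z) hχ0 hu0 hk2 hk
              hk' hRT (h.grad_le z) (h.neg_time_le z)
        _ ≤ T ^ (-q) * (χ z * (A + D * (ζ z ^ k * (T * u z) ^ q))) := by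
            gcongr
            exact hAD _ (by positivity)
        _ = χ z * (A * T ^ (-q)) + D * (χ z * (T ^ (-q) * (ζ z ^ k * (T * u z) ^ q))) := by ring
        _ ≤ 1 * (A * T ^ (-q)) + D * (χ z * (T ^ (-q) * (ζ z ^ k * (T * u z) ^ q))) := by
            gcongr
            exact h.χ_le_one z
        _ = _ := by rw [hTu]; ring
    · rw [indicator_of_notMem hzW]
      by_cases hzK : z ∈ tsupport (fun z => χ z * ζ z ^ k)
      · have h1 := h.tsupport_subset hzK
        have h2 : z ∈ ball (0 : Euc N) R ×ˢ Iio (T ^ (q - 1)) := by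
          by_contra h2
          exact hzW ⟨⟨h1.1, (inv_pos.2 hR).le.trans h1.2.1, h1.2.2⟩, h2⟩
        have h3 : ‖z.1‖ < R := mem_ball_zero_iff.1 h2.1
        have h4 : |z.2| < T ^ (q - 1) := by rw [abs_of_pos hz]; exact h2.2
        rw [h.grad_eq_zero z h3 h4, smul_zero, zero_add, real_inner_smul_left,
          real_inner_self_eq_norm_sq]
        have h5 : 0 ≤ tφ z * profilePrim (δ / T) s (u z) :=
          mul_nonneg (h.time_nonneg z h3 h4) (profilePrim_nonneg hε hs1 hu0)
        have h6 : 0 ≤ χ z * ζ z ^ k * profileSlope (δ / T) s (u z) * ‖gu z‖ ^ 2 * u z ^ σ *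
            ‖gu z‖ ^ (p - 2) * c := by
          have := hφ0 z
          have := (profileSlope_pos hε hs hu0).le
          positivity
        linarith
      · obtain ⟨h1, h2, h3⟩ := eq_zero_of_notMem_tsupport (h.hasFDerivAt z) hzK
        simp [h1, h2, h3]
  · rw [integral_indicator hW, integral_add hcW.integrable
      (hint.const_mul D).integrableOn.integrable, integral_const_mul D, setIntegral_const,
      smul_eq_mul]
    ring

end Cutoff

lemma exists_muS_outerCylinder_le {a : Euc N → ℝ} {Ca : ℝ} (hCa : ∀ x, |a x| ≤ Ca) (q : ℝ) :
    ∃ C : ℝ, 0 ≤ C ∧ ∀ R T : ℝ, 0 < R → 0 < T → R ^ N ≤ T →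
      T ^ (-q) * (muS a).real (outerCylinder N R (T ^ (q - 1))) ≤ C := by
  have hCa0 : 0 ≤ Ca := (abs_nonneg _).trans (hCa 0)
  set v := (volume : Measure (Euc N)).real (ball 0 1) with hv
  have hv0 : 0 ≤ v := measureReal_nonneg
  refine ⟨Ca * (2 ^ N * v) * 2, by positivity, fun R T hR hT hRT => ?_⟩
  have h1 : (muS a).real (outerCylinder N R (T ^ (q - 1))) ≤
      Ca * ((2 * R) ^ N * v) * (2 * T ^ (q - 1)) := by
    have h2 : muS a (outerCylinder N R (T ^ (q - 1))) ≤ _ := (measure_mono sdiff_subset).trans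
      (muS_prod_le hCa (closedBall (0 : Euc N) (2 * R)) measurableSet_closedBall
        (Icc 0 (2 * T ^ (q - 1))))
    rw [Measure.addHaar_closedBall _ _ (by positivity), Real.volume_Icc, sub_zero,
      finrank_euclideanSpace, Fintype.card_fin] at h2
    refine (ENNReal.toReal_mono ?_ h2).trans_eq ?_
    · exact ENNReal.mul_ne_top (ENNReal.mul_ne_top ENNReal.ofReal_ne_top
        (ENNReal.mul_ne_top ENNReal.ofReal_ne_top measure_ball_lt_top.ne)) ENNReal.ofReal_ne_top
    · rw [ENNReal.toReal_mul, ENNReal.toReal_mul, ENNReal.toReal_mul, ENNReal.toReal_ofReal hCa0,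
        ENNReal.toReal_ofReal (by positivity), ENNReal.toReal_ofReal (by positivity)]
      rfl
  calc T ^ (-q) * (muS a).real (outerCylinder N R (T ^ (q - 1)))
      ≤ T ^ (-q) * (Ca * ((2 * R) ^ N * v) * (2 * T ^ (q - 1))) := by gcongr
    _ = Ca * (2 ^ N * v) * 2 * (R ^ N / T) := by
      rw [rpow_sub_one hT.ne', rpow_neg hT.le, mul_pow]
      field_simp
    _ ≤ Ca * (2 ^ N * v) * 2 * 1 := by
      gcongr
      exact (div_le_one hT).2 hRT
    _ = _ := mul_one _

lemma IsWeakSol.ae_eq_zero {p q σ c Ca : ℝ} {a : Euc N → ℝ} {u ut : Euc N × ℝ → ℝ}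
    {gu : Euc N × ℝ → Euc N}
    (hu : IsWeakSol N p (σ + 1) q (fun _ => 1) (fun _ => c) a u gu ut) (hN : N ≠ 0) (hp : 1 < p)
    (hσ : 0 ≤ σ) (hq : 1 < q) (hq1 : σ + (p - 1) < q) (hq2 : q ≤ p / N + (σ + (p - 1)))
    (hc : 0 ≤ c) (haLip : LocallyLipschitz a) (ha0 : ∀ x, 0 ≤ a x) (hCa : ∀ x, |a x| ≤ Ca) :
    ∀ᵐ z ∂ muS a, u z = 0 := by
  have ha : Measurable a := haLip.continuous.measurable
  have hS := ae_mem_Sset (N := N) ha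
  have hq0 : 0 < q := by linarith
  have hN0 : (0 : ℝ) < N := by exact_mod_cast Nat.pos_of_ne_zero hN
  obtain ⟨s, hs, hs1, hl⟩ : ∃ s : ℝ, 0 < s ∧ s < 1 ∧ σ + (s + 1) * (p - 1) < q := by
    have hlim : Tendsto (fun s : ℝ => σ + (s + 1) * (p - 1)) (𝓝[>] 0) (𝓝 (σ + (0 + 1) * (p - 1))) :=
      Tendsto.mono_left (Continuous.tendsto (by fun_prop) 0) nhdsWithin_le_nhds
    have h1 := hlim.eventually_lt_const (u := q) (by linarith)
    obtain ⟨s, h2, h3⟩ := (h1.and (Ioo_mem_nhdsGT (zero_lt_one' ℝ))).exists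
    exact ⟨s, h3.1, h3.2, h2⟩
  set e := (σ + (s + 1) * (p - 1)) / q with he
  obtain ⟨k, hk2, hk, hk'⟩ : ∃ k : ℕ, 2 ≤ k ∧ k * e ≤ k - p ∧ (k : ℝ) * (1 / q) ≤ k - 1 := by
    have he1 : 0 < 1 - e := sub_pos.2 ((div_lt_one hq0).2 hl)
    have hq' : 0 < 1 - 1 / q := sub_pos.2 ((div_lt_one hq0).2 hq)
    have hcast := tendsto_natCast_atTop_atTop (R := ℝ)
    obtain ⟨k, h1, h2, h3⟩ := ((eventually_ge_atTop 2).and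
      (((hcast.atTop_mul_const he1).eventually_ge_atTop p).and
      ((hcast.atTop_mul_const hq').eventually_ge_atTop 1))).exists
    exact ⟨k, h1, by linarith, by linarith⟩
  obtain ⟨B, hB, hcut⟩ := exists_isCutoff N (k := k) (by omega)
  obtain ⟨C, hC, hCT⟩ := exists_muS_outerCylinder_le hCa q
  set M := c * ((k * B) ^ p * (s / 2) ^ (1 - p) * 2 ^ ((s + 1) * (p - 1))) + k * B with hM
  have hM0 : 0 ≤ M := by positivity
  set κ := p / (q - σ - (p - 1)) with hκ
  have hr : 0 < q - σ - (p - 1) := by linarith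
  have hκN : (N : ℝ) ≤ κ := by
    rw [hκ, le_div_iff₀ hr, ← le_div_iff₀' hN0]
    linarith
  let R : ℕ → ℝ := fun n => n + 1
  let T : ℕ → ℝ := fun n => R n ^ κ
  let L : ℕ → ℝ := fun n => T n ^ (q - 1)
  have hR1 : ∀ n, 1 ≤ R n := fun n => by simp [R]
  have hR : ∀ n, 0 < R n := fun n => zero_lt_one.trans_le (hR1 n)
  have hT : ∀ n, 0 < T n := fun n => rpow_pos_of_pos (hR n) _
  have hL : ∀ n, 0 < L n := fun n => rpow_pos_of_pos (hT n) _
  have hRT : ∀ n, R n ^ p = T n ^ (q - σ - (p - 1)) := fun n => by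
    rw [← rpow_mul (hR n).le, hκ, div_mul_cancel₀ _ hr.ne']
  have hRN : ∀ n, R n ^ N ≤ T n := fun n => by
    rw [← rpow_natCast]
    exact rpow_le_rpow_of_exponent_le (hR1 n) hκN
  have hRtop : Tendsto R atTop atTop :=
    tendsto_atTop_add_const_right _ _ tendsto_natCast_atTop_atTop
  have hLtop : Tendsto L atTop atTop :=
    (tendsto_rpow_atTop (by linarith)).comp ((tendsto_rpow_atTop (hN0.trans_le hκN)).comp hRtop)
  choose χ ζ tφ gφ hφ using fun n => hcut (R n) (hR n) (L n) (hL n)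
  let W : ℕ → Set (Euc N × ℝ) := fun n => outerCylinder N (R n) (L n)
  have hWm : ∀ n, MeasurableSet (W n) := fun n => measurableSet_outerCylinder _ _
  have hint := fun n => hu.integrable_cutoff hp hσ hq0.le haLip ha0 hCa (hφ n) (hR n)
  have huq : ∀ᵐ z ∂ muS a, 0 ≤ u z ^ q := by
    filter_upwards [hS] with z hz using rpow_nonneg (hu.nonneg z hz) q
  have hφ0 : ∀ n z, 0 ≤ χ n z * ζ n z ^ k := fun n z =>
    mul_nonneg ((hφ n).χ_nonneg z) (pow_nonneg ((hφ n).ζ_nonneg z) k)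
  have hφ1 : ∀ n z, χ n z * ζ n z ^ k ≤ 1 := fun n z =>
    mul_le_one₀ ((hφ n).χ_le_one z) (pow_nonneg ((hφ n).ζ_nonneg z) k)
      (pow_le_one₀ ((hφ n).ζ_nonneg z) ((hφ n).ζ_le_one z))
  have hφu : ∀ n, ∀ᵐ z ∂ muS a, 0 ≤ χ n z * ζ n z ^ k * u z ^ q := fun n => by
    filter_upwards [huq] with z hz using mul_nonneg (hφ0 n z) hz
  have hkey : ∀ n (δ A D : ℝ), 0 < δ → 0 ≤ A → 0 ≤ D →
      (∀ X : ℝ, 0 ≤ X → M * errorTerm p σ s q δ X ≤ A + D * X) →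
      1 / 2 * ∫ z, χ n z * ζ n z ^ k * u z ^ q ∂ muS a ≤
        A * C + D * ∫ z in W n, χ n z * ζ n z ^ k * u z ^ q ∂ muS a := by
    intro n δ A D hδ hA hD hAD
    refine (hu.integral_cutoff_le hp hσ hq0 hc haLip ha0 hCa hs hs1 hδ (hT n) (hR n) hB hk2 hk hk'
      (hRT n) (hφ n) hA hAD).trans ?_
    gcongr
    exact hCT _ _ (hR n) (hT n) (hRN n)
  let E : ℕ → Set (Euc N × ℝ) := fun n =>
    {z | ‖z.1‖ ≤ R n ∧ 2 * (R n)⁻¹ ≤ z.2 ∧ z.2 ≤ L n}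
  have hEm : ∀ n, MeasurableSet (E n) := fun n => by measurability
  have hE : AECover (muS a) atTop E := by
    refine ⟨?_, hEm⟩
    filter_upwards [hS] with z hz
    have h1 : Tendsto (fun n => 2 * (R n)⁻¹) atTop (𝓝 (2 * 0)) :=
      (tendsto_inv_atTop_zero.comp hRtop).const_mul 2
    rw [mul_zero] at h1
    filter_upwards [hRtop.eventually_ge_atTop ‖z.1‖, h1.eventually_le_const hz,
      hLtop.eventually_ge_atTop z.2] with n h2 h3 h4 using ⟨h2, h3, h4⟩
  have hWc : AECover (muS a) atTop (fun n => (W n)ᶜ) := by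
    refine ⟨?_, fun n => (hWm n).compl⟩
    refine Eventually.of_forall fun z => ?_
    filter_upwards [hRtop.eventually_gt_atTop ‖z.1‖, hLtop.eventually_gt_atTop z.2]
      with n h2 h3 h4
    exact h4.2 ⟨mem_ball_zero_iff.2 h2, h3⟩
  have hEeq : ∀ n, EqOn (fun z => χ n z * ζ n z ^ k * u z ^ q) (fun z => u z ^ q) (E n) :=
    fun n z hz => by
      change χ n z * ζ n z ^ k * u z ^ q = u z ^ q
      rw [(hφ n).eq_one z hz.1 hz.2.1 hz.2.2, one_mul]
  have hEint : ∀ n, IntegrableOn (fun z => u z ^ q) (E n) (muS a) := fun n =>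
    (hint n).integrableOn.congr_fun (hEeq n) (hEm n)
  have hEle : ∀ n, ∫ z in E n, u z ^ q ∂ muS a ≤ ∫ z, χ n z * ζ n z ^ k * u z ^ q ∂ muS a :=
    fun n => by
      rw [← setIntegral_congr_fun (hEm n) (hEeq n)]
      exact setIntegral_le_integral (hint n) (hφu n)
  have hInt : Integrable (fun z => u z ^ q) (muS a) := by
    obtain ⟨A, hA, hAX⟩ := exists_errorTerm_le_mul_add_const hp hσ hs hq hl hM0
      (by norm_num : (0 : ℝ) < 1 / 4)
    refine hE.integrable_of_integral_bounded_of_nonneg_ae (4 * (A * C)) hEint huq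
      (Eventually.of_forall fun n => (hEle n).trans ?_)
    have h1 := hkey n 1 A (1 / 4) one_pos hA (by norm_num) hAX
    have h2 := setIntegral_le_integral (s := W n) (hint n) (hφu n)
    linarith
  have hWlim : Tendsto (fun n => ∫ z in W n, u z ^ q ∂ muS a) atTop (𝓝 0) := by
    have h1 := (hWc.integral_tendsto_of_countably_generated hInt).const_sub (∫ z, u z ^ q ∂ muS a)
    rw [sub_self] at h1
    refine h1.congr fun n => ?_
    rw [← integral_add_compl (hWm n) hInt]
    ring
  have hbound : ∀ ω : ℝ, 0 < ω → 1 / 2 * ∫ z, u z ^ q ∂ muS a ≤ ω * C := by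
    intro ω hω
    obtain ⟨δ, hδ, D, hD, hDX⟩ := exists_errorTerm_le_const_add_mul hp hσ hs hq hl hM0 hω
    have h1 : Tendsto (fun n => ω * C + D * ∫ z in W n, u z ^ q ∂ muS a) atTop
        (𝓝 (ω * C + D * 0)) := (hWlim.const_mul D).const_add _
    rw [mul_zero, add_zero] at h1
    refine le_of_tendsto_of_tendsto'
      ((hE.integral_tendsto_of_countably_generated hInt).const_mul (1 / 2)) h1 fun n => ?_
    have h2 := hkey n δ ω D hδ hω.le hD hDX
    have h3 : ∫ z in W n, χ n z * ζ n z ^ k * u z ^ q ∂ muS a ≤ ∫ z in W n, u z ^ q ∂ muS a := by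
      refine integral_mono_ae (hint n).integrableOn hInt.integrableOn (ae_restrict_of_ae ?_)
      filter_upwards [huq] with z hz using mul_le_of_le_one_left hz (hφ1 n z)
    have h4 := mul_le_mul_of_nonneg_left h3 hD
    have h5 := hEle n
    linarith
  have hzero : ∫ z, u z ^ q ∂ muS a = 0 := by
    refine le_antisymm ?_ (integral_nonneg_of_ae huq)
    have h1 : Tendsto (fun ω : ℝ => ω * C) (𝓝[>] 0) (𝓝 (0 * C)) :=
      Tendsto.mono_left (Continuous.tendsto (by fun_prop) 0) nhdsWithin_le_nhds
    have h2 := ge_of_tendsto h1 (eventually_mem_nhdsWithin.mono fun ω hω => hbound ω hω)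
    linarith
  filter_upwards [(integral_eq_zero_iff_of_nonneg_ae huq hInt).1 hzero, hS] with z hz hzS
  exact (rpow_eq_zero (hu.nonneg z hzS) hq0.ne').1 hz

end WeakSolutions

/-- Doubly nonlinear diffusion (I1), Euclidean case: nonexistence for
`∂ₜ u ≥ Δ_p(u^γ) + u^q` with `m = (γ-1)(p-1)+1`, `f ≡ γ^(p-1)`. -/
theorem doubly_nonlinear_nonexistence
    (N : ℕ) (hN : 1 ≤ N) (p γ q : ℝ) (hp : 1 < p) (hγ : 1 ≤ γ)
    (a : Euc N → ℝ)
    (haLip : LocallyLipschitz a)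
    (haPos : ∀ᵐ x ∂ (volume : Measure (Euc N)), 0 < a x)
    (haBdd : ∃ Ca : ℝ, ∀ x, |a x| ≤ Ca)
    (hq1 : max 1 (γ * (p - 1)) < q) (hq2 : q ≤ p / (N : ℝ) + γ * (p - 1))
    (u : Euc N × ℝ → ℝ) (gu : Euc N × ℝ → Euc N) (ut : Euc N × ℝ → ℝ)
    (hu : IsWeakSol N p ((γ - 1) * (p - 1) + 1) q (fun _ => 1)
      (fun _ => γ ^ (p - 1)) a u gu ut) :
    (∀ᵐ z ∂ ((volume : Measure (Euc N × ℝ)).restrict (Sset N)), u z = 0) ∧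
      p > (N : ℝ) * (γ + 1) / (γ * (N : ℝ) + 1) := by
  obtain ⟨Ca, hCa⟩ := haBdd
  have ha0 := nonneg_of_ae_pos haLip haPos
  have hp' : 0 < p - 1 := by linarith
  have hN0 : (0 : ℝ) < N := by exact_mod_cast hN
  have hq : 1 < q := (le_max_left _ _).trans_lt hq1
  refine ⟨(absolutelyContinuous_muS haLip.continuous.measurable haPos).ae_le
    (hu.ae_eq_zero (by omega) hp (mul_nonneg (by linarith) hp'.le) hq ?_ ?_ (by positivity) haLip
      ha0 hCa), ?_⟩
  · have := (le_max_right _ _).trans_lt hq1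
    linarith
  · linarith
  · have h1 : (1 - γ * (p - 1)) * N < p := by
      rw [← lt_div_iff₀ hN0]
      linarith
    rw [gt_iff_lt, div_lt_iff₀ (by positivity)]
    linarith

end
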